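/- Let γ ∈ ℝ with γ > d, let |·| be either the Euclidean norm |·|₂ or the sup norm |·|_∞ on ℝ^d, and let K(x) = Σ_{l∈ℤ^d∖{0}} |l|^{−γ} e^{i l·x} for x ∈ 𝕋^d. For n ∈ ℕ let n = (n,…,n) ∈ ℕ^d. Then for every 1 ≤ p ≤ 2 ≤ q ≤ ∞ with 1/p − 1/q ≥ 1/2 there is a constant C_{p,q} > 0, independent of n, such that sup_{f ∈ K*U_p} ‖f − sk_n(f,·)‖_q ≤ C_{p,q}·n^{−γ + d(1/p − 1/q)} for all n ≥ 1. -/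

import Mathlib

open Real Finset MeasureTheory ENNReal

noncomputable section

/-- The index set `Ω_n = {j ∈ ℤ^d : 0 ≤ j_l ≤ 2 n_l - 1}`. -/
def Omega (d : ℕ) (n : Fin d → ℕ) : Finset (Fin d → ℤ) :=
  Fintype.piFinset fun i => Finset.Icc (0 : ℤ) (2 * (n i : ℤ) - 1)

/-- The knot `x_k = (π k₁ / n₁, …, π k_d / n_d)`. -/
def knot (d : ℕ) (n : Fin d → ℕ) (k : Fin d → ℤ) : Fin d → ℝ :=
  fun i => π * (k i : ℝ) / (n i : ℝ)

/-- The dot product `l · x` for `l ∈ ℤ^d`, `x ∈ ℝ^d`. -/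
def dotI (d : ℕ) (l : Fin d → ℤ) (x : Fin d → ℝ) : ℝ := ∑ i, (l i : ℝ) * x i

/-- `N = 2^d n₁ ⋯ n_d`. -/
def Nn (d : ℕ) (n : Fin d → ℕ) : ℝ := ∏ i : Fin d, (2 * (n i : ℝ))

/-- `Ω_n^* = Ω_n \ {0}`. -/
def OmegaStar (d : ℕ) (n : Fin d → ℕ) : Finset (Fin d → ℤ) :=
  (Omega d n).erase 0

/-- `λ_j(x) = Σ_{k ∈ Ω_n} e^{i j·x_k} K(x - x_k)`. -/
def lam (d : ℕ) (n : Fin d → ℕ) (K : (Fin d → ℝ) → ℝ) (j : Fin d → ℤ)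
    (x : Fin d → ℝ) : ℂ :=
  ∑ k ∈ Omega d n, Complex.exp (Complex.I * (dotI d j (knot d n k) : ℂ)) *
    (K (x - knot d n k) : ℂ)

/-- `ρ_j(x) = (2/N)·Re λ_j(x)`. -/
def rho (d : ℕ) (n : Fin d → ℕ) (K : (Fin d → ℝ) → ℝ) (j : Fin d → ℤ)
    (x : Fin d → ℝ) : ℝ := (2 / Nn d n) * (lam d n K j x).re

/-- `σ_j(x) = (2/N)·Im λ_j(x)`. -/
def sigma' (d : ℕ) (n : Fin d → ℕ) (K : (Fin d → ℝ) → ℝ) (j : Fin d → ℤ)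
    (x : Fin d → ℝ) : ℝ := (2 / Nn d n) * (lam d n K j x).im

/-- The fundamental sk-spline `s̃k_n(x) = 1/N + (1/N) Σ_{j∈Ω_n*} ρ_j(x)/ρ_j(0)`. -/
def fundSk (d : ℕ) (n : Fin d → ℕ) (K : (Fin d → ℝ) → ℝ) (x : Fin d → ℝ) : ℝ :=
  1 / Nn d n + (1 / Nn d n) * ∑ j ∈ OmegaStar d n, rho d n K j x / rho d n K j 0

/-- The interpolating sk-spline `sk_n(f,x) = Σ_{k∈Ω_n} f(x_k) s̃k_n(x - x_k)`. -/
def skInterp (d : ℕ) (n : Fin d → ℕ) (K : (Fin d → ℝ) → ℝ)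
    (f : (Fin d → ℝ) → ℝ) (x : Fin d → ℝ) : ℝ :=
  ∑ k ∈ Omega d n, f (knot d n k) * fundSk d n K (x - knot d n k)

/-- The (complex-valued) kernel `K(x) = Σ_{l ∈ ℤ^d} a_l e^{i l·x}`. -/
def Kc (d : ℕ) (a : (Fin d → ℤ) → ℝ) (x : Fin d → ℝ) : ℂ :=
  ∑' l : Fin d → ℤ, (a l : ℂ) * Complex.exp (Complex.I * (dotI d l x : ℂ))

/-- The real part of the kernel; for `a_l = a_{-l}` this is the kernel itself. -/
def Kr (d : ℕ) (a : (Fin d → ℤ) → ℝ) (x : Fin d → ℝ) : ℝ := (Kc d a x).re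

/-- The normalized measure on the torus, modelled as the normalized Lebesgue
measure on the fundamental domain `[0, 2π)^d`. -/
def nu (d : ℕ) : Measure (Fin d → ℝ) :=
  (ENNReal.ofReal ((2 * π) ^ d))⁻¹ •
    (volume.restrict (Set.univ.pi fun _ : Fin d => Set.Ico (0:ℝ) (2 * π)))

/-- The convolution `K * φ` with respect to the normalized measure `ν`. -/
def convK (d : ℕ) (K : (Fin d → ℝ) → ℝ) (φ : (Fin d → ℝ) → ℝ)
    (x : Fin d → ℝ) : ℝ := ∫ y, K (x - y) * φ y ∂(nu d)

/-- The coefficients `a_l = |l|^{-γ}` for `l ≠ 0` and `a_0 = 0`. -/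
def aGamma (d : ℕ) (γ : ℝ) (nrm : (Fin d → ℝ) → ℝ) : (Fin d → ℤ) → ℝ :=
  fun l => if l = 0 then 0 else nrm (fun i => (l i : ℝ)) ^ (-γ)

theorem summable_one_add_norm_rpow (d : ℕ) {γ : ℝ} (hγ : (d : ℝ) < γ) :
    Summable fun m : Fin d → ℤ => (1 + ‖m‖) ^ (-γ) := by
  let b := Pi.basisFun ℝ (Fin d)
  let L : Submodule ℤ (Fin d → ℝ) := Submodule.span ℤ (Set.range b)
  have hrank : Module.finrank ℤ L = d := by
    rw [ZLattice.rank ℝ L]; simp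
  have hs := ZLattice.summable_norm_rpow L (-γ) (by rw [hrank]; linarith)
  let e : (Fin d → ℤ) → L := fun m => ⟨fun i => (m i : ℝ), by
    rw [Module.Basis.mem_span_iff_repr_mem]
    intro i
    exact ⟨m i, by simp [b]⟩⟩
  have he : Function.Injective e := by
    intro m m' h
    have := congrArg Subtype.val h
    funext i
    have := congrFun this i
    simpa [e] using this
  have hn : ∀ m, ‖e m‖ = ‖m‖ := fun m => by
    simp only [e, Submodule.coe_norm]
    simp [Pi.norm_def]
    congr 1
  have h2 := hs.comp_injective he
  refine Summable.of_norm_bounded_eventually h2 ?_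
  refine (Set.finite_singleton (0 : Fin d → ℤ)).subset fun m hm => ?_
  by_contra h0
  apply hm
  have : 0 < ‖m‖ := norm_pos_iff.2 h0
  change ‖(1 + ‖m‖) ^ (-γ)‖ ≤ ‖e m‖ ^ (-γ)
  rw [hn, Real.norm_of_nonneg (by positivity)]
  have : (0 : ℝ) ≤ d := by positivity
  exact Real.rpow_le_rpow_of_nonpos ‹_› (by linarith) (by linarith)

/-- The weight `max(n, ‖l‖)^{-γ}` which dominates the aliasing coefficients. -/
def truncWeight (d n : ℕ) (γ : ℝ) (l : Fin d → ℤ) : ℝ := (max (n : ℝ) ‖l‖) ^ (-γ)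

theorem truncWeight_nonneg (d n : ℕ) (γ : ℝ) (l : Fin d → ℤ) : 0 ≤ truncWeight d n γ l :=
  Real.rpow_nonneg (le_max_of_le_left (by positivity)) _

theorem truncWeight_le {d n : ℕ} (hn : 1 ≤ n) {γ : ℝ} (hγ : 0 ≤ γ) (l : Fin d → ℤ) :
    truncWeight d n γ l ≤ (n : ℝ) ^ (-γ) :=
  Real.rpow_le_rpow_of_nonpos (by positivity) (le_max_left _ _) (by linarith)

theorem two_mul_norm_le_of_two_mul_abs_le {d n : ℕ} {l l' m : Fin d → ℤ}
    (h : ∀ i, 2 * (n : ℤ) * |m i| ≤ |l' i| + l i) (C : ℝ) (hC : ∀ i, (l i : ℝ) ≤ C)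
    (h0 : 0 ≤ C) :
    2 * (n : ℝ) * ‖m‖ ≤ ‖l'‖ + C := by
  by_cases hn : n = 0
  · subst hn; simp; positivity
  have hn' : (0 : ℝ) < 2 * n := by positivity
  rw [← le_div_iff₀' hn', pi_norm_le_iff_of_nonneg (by positivity)]
  intro i
  rw [le_div_iff₀' hn', Int.norm_eq_abs]
  have h1 : (2 * (n : ℝ) * |(m i : ℝ)|) ≤ |(l' i : ℝ)| + l i := by exact_mod_cast h i
  have h2 : |(l' i : ℝ)| ≤ ‖l'‖ := by rw [← Int.norm_eq_abs]; exact norm_le_pi_norm l' i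
  linarith [hC i]

theorem truncWeight_add_le {d n : ℕ} (hn : 1 ≤ n) {γ : ℝ} (hγ : 0 ≤ γ)
    (l m : Fin d → ℤ) (h : ∀ i, 2 * (n : ℤ) * |m i| ≤ |l i| + 2 * n) :
    truncWeight d n γ l ≤ 2 ^ γ * (n : ℝ) ^ (-γ) * (1 + ‖m‖) ^ (-γ) := by
  have h1 := two_mul_norm_le_of_two_mul_abs_le (n := n) (l := fun _ => 2 * (n : ℤ)) h (2 * n)
    (by intro i; push_cast; exact le_rfl) (by positivity)
  have hn' : (1 : ℝ) ≤ n := by exact_mod_cast hn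
  have h2 : (n : ℝ) * (1 + ‖m‖) / 2 ≤ max (n : ℝ) ‖l‖ := by
    rcases le_total ‖m‖ 1 with h | h
    · apply le_max_of_le_left; nlinarith
    · rcases le_total ‖m‖ (5 / 3) with h' | h'
      · have hm : ‖m‖ ≤ 1 := by
          have h3 := (pi_norm_le_iff_of_nonneg (norm_nonneg m)).1 (le_refl ‖m‖)
          rw [pi_norm_le_iff_of_nonneg zero_le_one]
          intro i
          have h4 := (h3 i).trans h'
          rw [Int.norm_eq_abs] at h4 ⊢
          have : |m i| < 2 := by
            have : |(m i : ℝ)| < 2 := by linarith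
            exact_mod_cast this
          have : |m i| ≤ 1 := by omega
          exact_mod_cast this
        apply le_max_of_le_left; nlinarith
      · apply le_max_of_le_right; nlinarith
  unfold truncWeight
  calc _ ≤ ((n : ℝ) * (1 + ‖m‖) / 2) ^ (-γ) :=
        Real.rpow_le_rpow_of_nonpos (by positivity) h2 (by linarith)
    _ = _ := by
      rw [Real.div_rpow (by positivity) (by norm_num),
        Real.mul_rpow (by positivity) (by positivity), Real.rpow_neg (by norm_num : (0:ℝ) ≤ 2)]
      field_simp

/-- Division with remainder by `2 n` in each coordinate. -/
def divModPi (d N : ℕ) [NeZero N] : (Fin d → ℤ) ≃ (Fin d → ℤ) × (Fin d → Fin N) :=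
  (Equiv.piCongrRight fun _ => Int.divModEquiv N).trans (Equiv.arrowProdEquivProdArrow _ _ _)

theorem summable_truncWeight {d n : ℕ} (hn : 1 ≤ n) {γ : ℝ} (hγ : (d : ℝ) < γ) :
    Summable (truncWeight d n γ) ∧ ∑' l, truncWeight d n γ l ≤
      2 ^ d * 2 ^ γ * (∑' m : Fin d → ℤ, (1 + ‖m‖) ^ (-γ)) * (n : ℝ) ^ (d - γ) := by
  have hγ0 : 0 ≤ γ := (Nat.cast_nonneg d).trans hγ.le
  have : NeZero (2 * n) := ⟨by omega⟩
  let e := divModPi d (2 * n)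
  have hS := summable_one_add_norm_rpow d hγ
  have hle : ∀ p, truncWeight d n γ (e.symm p) ≤
      2 ^ γ * (n : ℝ) ^ (-γ) * (1 + ‖p.1‖) ^ (-γ) := by
    intro p
    apply truncWeight_add_le hn hγ0
    intro i
    have : e.symm p i = p.1 i * ((2 * n : ℕ) : ℤ) + (p.2 i : ℕ) := rfl
    rw [this]
    have h3 := (p.2 i).2
    have h4 : ((p.2 i : ℕ) : ℤ) < 2 * n := by exact_mod_cast h3
    push_cast
    have h5 : |p.1 i * (2 * (n : ℤ))| = 2 * n * |p.1 i| := by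
      rw [abs_mul, abs_of_nonneg (by positivity : (0:ℤ) ≤ 2 * n), mul_comm]
    rw [← h5]
    have h6 := abs_sub_abs_le_abs_sub (p.1 i * (2 * (n : ℤ)))
      (p.1 i * (2 * (n : ℤ)) + ((p.2 i : ℕ) : ℤ))
    have h7 : |p.1 i * (2 * (n : ℤ)) - (p.1 i * (2 * (n : ℤ)) + ((p.2 i : ℕ) : ℤ))|
      = ((p.2 i : ℕ) : ℤ) := by
      rw [sub_add_cancel_left, abs_neg, abs_of_nonneg (by positivity)]
    rw [h7] at h6
    linarith
  have hprod : HasSum (fun p : (Fin d → ℤ) × (Fin d → Fin (2 * n)) =>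
      2 ^ γ * (n : ℝ) ^ (-γ) * (1 + ‖p.1‖) ^ (-γ) * 1)
      (2 ^ γ * (n : ℝ) ^ (-γ) * (∑' m : Fin d → ℤ, (1 + ‖m‖) ^ (-γ)) *
        ∑ _r : Fin d → Fin (2 * n), (1 : ℝ)) := by
    have h1 := hS.hasSum.mul_left (2 ^ γ * (n : ℝ) ^ (-γ))
    have h2 := hasSum_fintype (fun _ : Fin d → Fin (2 * n) => (1 : ℝ))
    exact h1.mul h2 (h1.summable.mul_of_nonneg h2.summable (fun _ => by positivity)
      (fun _ => zero_le_one))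
  have hsum : Summable fun p => truncWeight d n γ (e.symm p) :=
    Summable.of_nonneg_of_le (fun _ => truncWeight_nonneg _ _ _ _)
      (fun p => by simpa using hle p) hprod.summable
  refine ⟨(e.symm.summable_iff).1 hsum, ?_⟩
  rw [← e.symm.tsum_eq]
  refine (hsum.tsum_le_tsum (fun p => by simpa using hle p) hprod.summable).trans_eq ?_
  rw [hprod.tsum_eq]
  have hn' : (0 : ℝ) < n := by exact_mod_cast hn
  rw [sub_eq_add_neg, Real.rpow_add hn', Real.rpow_natCast]
  simp [mul_pow]
  ring

/-- The character `e^{i l·x}`. -/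
def torusChar (d : ℕ) (l : Fin d → ℤ) (x : Fin d → ℝ) : ℂ :=
  Complex.exp (Complex.I * (dotI d l x : ℂ))

theorem dotI_eq_dotProduct (d : ℕ) (l : Fin d → ℤ) (x : Fin d → ℝ) :
    dotI d l x = (fun i => (l i : ℝ)) ⬝ᵥ x := rfl

theorem torusChar_add_right (d : ℕ) (l : Fin d → ℤ) (x y : Fin d → ℝ) :
    torusChar d l (x + y) = torusChar d l x * torusChar d l y := by
  simp only [torusChar, dotI_eq_dotProduct, dotProduct_add]
  push_cast
  rw [mul_add, Complex.exp_add]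

theorem torusChar_add_left (d : ℕ) (l m : Fin d → ℤ) (x : Fin d → ℝ) :
    torusChar d (l + m) x = torusChar d l x * torusChar d m x := by
  rw [torusChar, torusChar, torusChar, ← Complex.exp_add, ← mul_add, ← Complex.ofReal_add]
  simp [dotI, add_mul, Finset.sum_add_distrib]

theorem torusChar_neg_right (d : ℕ) (l : Fin d → ℤ) (x : Fin d → ℝ) :
    torusChar d l (-x) = torusChar d (-l) x := by
  simp [torusChar, dotI]

theorem torusChar_neg_left (d : ℕ) (l : Fin d → ℤ) (x : Fin d → ℝ) :
    torusChar d (-l) x = (starRingEnd ℂ) (torusChar d l x) := by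
  simp [torusChar, dotI, ← Complex.exp_conj]

theorem torusChar_sub_right (d : ℕ) (l : Fin d → ℤ) (x y : Fin d → ℝ) :
    torusChar d l (x - y) = torusChar d l x * torusChar d (-l) y := by
  rw [sub_eq_add_neg, torusChar_add_right, torusChar_neg_right]

theorem norm_torusChar (d : ℕ) (l : Fin d → ℤ) (x : Fin d → ℝ) : ‖torusChar d l x‖ = 1 := by
  rw [torusChar, mul_comm, Complex.norm_exp_ofReal_mul_I]

theorem torusChar_zero_left (d : ℕ) (x : Fin d → ℝ) : torusChar d 0 x = 1 := by
  simp [torusChar, dotI]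

theorem torusChar_zero_right (d : ℕ) (l : Fin d → ℤ) : torusChar d l 0 = 1 := by
  simp [torusChar, dotI]

theorem continuous_torusChar (d : ℕ) (l : Fin d → ℤ) : Continuous (torusChar d l) := by
  unfold torusChar dotI
  fun_prop

theorem torusChar_eq_prod (d : ℕ) (l : Fin d → ℤ) (x : Fin d → ℝ) :
    torusChar d l x = ∏ i, Complex.exp (Complex.I * (((l i : ℝ) * x i : ℝ) : ℂ)) := by
  rw [torusChar, dotI, ← Complex.exp_sum]
  push_cast
  rw [Finset.mul_sum]

/-- Congruence of integer vectors modulo `2 n` in each coordinate. -/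
def GridCongr (d n : ℕ) (l m : Fin d → ℤ) : Prop := ∀ i, 2 * (n : ℤ) ∣ l i - m i

theorem sum_Icc_exp {n : ℕ} (hn : 1 ≤ n) (a : ℤ) :
    ∑ k ∈ Finset.Icc (0 : ℤ) (2 * (n : ℤ) - 1),
      Complex.exp (Complex.I * (((a : ℝ) * (π * (k : ℝ) / (n : ℝ)) : ℝ) : ℂ)) =
    if 2 * (n : ℤ) ∣ a then 2 * (n : ℂ) else 0 := by
  have hn0 : (n : ℂ) ≠ 0 := by exact_mod_cast (by omega : n ≠ 0)
  have h1 : Finset.Icc (0 : ℤ) (2 * (n : ℤ) - 1) =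
      (Finset.range (2 * n)).map Nat.castEmbedding := by
    ext k
    simp only [Finset.mem_Icc, Finset.mem_map, Finset.mem_range, Nat.castEmbedding_apply]
    constructor
    · intro h
      exact ⟨k.toNat, by omega, by omega⟩
    · rintro ⟨k, hk, rfl⟩
      omega
  rw [h1, Finset.sum_map]
  set z : ℂ := Complex.exp (Complex.I * ((a : ℂ) * (π / n))) with hz
  have h2 : ∀ k : ℕ, Complex.exp (Complex.I * (((a : ℝ) * (π * (((Nat.castEmbedding k : ℤ)) : ℝ)
      / (n : ℝ)) : ℝ) : ℂ)) = z ^ k := by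
    intro k
    rw [hz, ← Complex.exp_nat_mul]
    congr 1
    push_cast [Nat.castEmbedding_apply]
    ring
  rw [Finset.sum_congr rfl fun k _ => h2 k]
  have hpow : z ^ (2 * n) = 1 := by
    rw [hz, ← Complex.exp_nat_mul, Complex.exp_eq_one_iff]
    refine ⟨a, ?_⟩
    push_cast
    field_simp
  have hone : z = 1 ↔ 2 * (n : ℤ) ∣ a := by
    rw [hz, Complex.exp_eq_one_iff]
    have hpi : (π : ℂ) ≠ 0 := by exact_mod_cast Real.pi_ne_zero
    constructor
    · rintro ⟨m, hm⟩
      refine ⟨m, ?_⟩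
      have : (a : ℂ) = 2 * n * m := by
        field_simp at hm
        linear_combination hm
      exact_mod_cast this
    · rintro ⟨m, rfl⟩
      refine ⟨m, ?_⟩
      push_cast
      field_simp
  split_ifs with h
  · rw [hone.2 h]; simp
  · rw [geom_sum_eq (fun h' => h (hone.1 h')), hpow]; simp

open Classical in
theorem sum_torusChar_knot {d n : ℕ} (hn : 1 ≤ n) (l m : Fin d → ℤ) :
    ∑ k ∈ Omega d (fun _ => n), torusChar d (l - m) (knot d (fun _ => n) k) =
    if GridCongr d n l m then (Nn d (fun _ => n) : ℂ) else 0 := by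
  simp only [torusChar_eq_prod, knot, Omega]
  rw [← Finset.prod_univ_sum (fun _ => Finset.Icc (0 : ℤ) (2 * (n : ℤ) - 1))
    (fun i k => Complex.exp (Complex.I * ((((l - m) i : ℤ) : ℝ) * (π * (k : ℝ) / (n : ℝ)) : ℝ)))]
  simp only [sum_Icc_exp hn, GridCongr, Nn, Pi.sub_apply]
  split_ifs with h
  · simp [h]
  · push Not at h
    obtain ⟨i, hi⟩ := h
    exact Finset.prod_eq_zero (Finset.mem_univ i) (by simp [hi])

theorem GridCongr.refl (d n : ℕ) (l : Fin d → ℤ) : GridCongr d n l l := fun i => by simp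

theorem GridCongr.symm {d n : ℕ} {l m : Fin d → ℤ} (h : GridCongr d n l m) : GridCongr d n m l :=
  fun i => by simpa using (h i).neg_right

theorem GridCongr.neg {d n : ℕ} {l m : Fin d → ℤ} (h : GridCongr d n l m) :
    GridCongr d n (-l) (-m) :=
  fun i => by
    have := (h i).neg_right
    rwa [show -(l i - m i) = (-l) i - (-m) i by simp; ring] at this

theorem torusChar_knot_of_gridCongr {d n : ℕ} (hn : 1 ≤ n) {l m : Fin d → ℤ}
    (h : GridCongr d n l m) (k : Fin d → ℤ) :
    torusChar d l (knot d (fun _ => n) k) = torusChar d m (knot d (fun _ => n) k) := by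
  choose c hc using h
  have hl : l = m + fun i => 2 * (n : ℤ) * c i := by
    funext i; simp [← hc i]
  rw [hl, torusChar_add_left]
  have : torusChar d (fun i => 2 * (n : ℤ) * c i) (knot d (fun _ => n) k) = 1 := by
    rw [torusChar_eq_prod]
    apply Finset.prod_eq_one
    intro i _
    rw [Complex.exp_eq_one_iff]
    have hn0 : (n : ℂ) ≠ 0 := by exact_mod_cast (by omega : n ≠ 0)
    refine ⟨c i * k i, ?_⟩
    simp only [knot]
    push_cast
    field_simp
  rw [this, mul_one]

open Classical in
theorem sum_OmegaStar_gridCongr {d n : ℕ} (hn : 1 ≤ n) (l : Fin d → ℤ) :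
    ∑ j ∈ OmegaStar d (fun _ => n), (if GridCongr d n l j then (1 : ℂ) else 0) =
    if GridCongr d n l 0 then 0 else 1 := by
  have hpos : (0 : ℤ) < 2 * n := by positivity
  have key : ∀ j ∈ Omega d (fun _ => n), GridCongr d n l j → j = fun i => l i % (2 * n) := by
    intro j hj h
    funext i
    have h1 := (Fintype.mem_piFinset.1 hj) i
    rw [Finset.mem_Icc] at h1
    have h2 : j i ≤ 2 * (n : ℤ) - 1 := h1.2
    rw [Int.ModEq.eq ((Int.modEq_iff_dvd.2 (h i)).symm), Int.emod_eq_of_lt h1.1 (by omega)]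
  have hcongr : GridCongr d n l (fun i => l i % (2 * n)) := fun i => Int.dvd_self_sub_emod
  have hmem : (fun i => l i % (2 * (n : ℤ))) ∈ Omega d (fun _ => n) := by
    rw [Omega, Fintype.mem_piFinset]
    intro i
    rw [Finset.mem_Icc]
    exact ⟨Int.emod_nonneg _ hpos.ne', Int.le_sub_one_of_lt (Int.emod_lt_of_pos _ hpos)⟩
  split_ifs with h
  · apply Finset.sum_eq_zero
    intro j hj
    rw [OmegaStar, Finset.mem_erase] at hj
    rw [if_neg]
    intro hlj
    have h0 : (0 : Fin d → ℤ) ∈ Omega d (fun _ => n) := by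
      rw [Omega, Fintype.mem_piFinset]
      intro i
      have : (1 : ℤ) ≤ n := by exact_mod_cast hn
      simp only [Finset.mem_Icc, Pi.zero_apply]
      omega
    exact hj.1 ((key j hj.2 hlj).trans (key 0 h0 h).symm)
  · rw [Finset.sum_eq_single_of_mem (fun i => l i % (2 * (n : ℤ)))]
    · rw [if_pos hcongr]
    · rw [OmegaStar, Finset.mem_erase]
      refine ⟨fun h0 => h ?_, hmem⟩
      rwa [h0] at hcongr
    · intro j hj hne
      rw [OmegaStar, Finset.mem_erase] at hj
      rw [if_neg]
      exact fun hlj => hne (key j hj.2 hlj)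

theorem gridCongr_neg_right {d n : ℕ} {l m : Fin d → ℤ} :
    GridCongr d n l (-m) ↔ GridCongr d n (-l) m :=
  ⟨fun h => by simpa using h.neg, fun h => by simpa using h.neg⟩

section Kernel

variable {d n : ℕ} {a : (Fin d → ℤ) → ℝ}

theorem summable_mul_torusChar (ha : Summable fun l => |a l|) (x : Fin d → ℝ) :
    Summable fun l => (a l : ℂ) * torusChar d l x := by
  refine Summable.of_norm_bounded ha fun l => ?_
  rw [norm_mul, norm_torusChar, mul_one, Complex.norm_real, Real.norm_eq_abs]

theorem Kc_eq (a : (Fin d → ℤ) → ℝ) (x : Fin d → ℝ) :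
    Kc d a x = ∑' l, (a l : ℂ) * torusChar d l x := rfl

theorem conj_Kc (hev : ∀ l, a (-l) = a l) (x : Fin d → ℝ) :
    (starRingEnd ℂ) (Kc d a x) = Kc d a x := by
  rw [Kc_eq, Complex.conj_tsum, ← (Equiv.neg (Fin d → ℤ)).tsum_eq]
  refine tsum_congr fun l => ?_
  rw [Equiv.neg_apply, map_mul, Complex.conj_ofReal, hev, ← torusChar_neg_left, neg_neg]

theorem ofReal_Kr (hev : ∀ l, a (-l) = a l) (x : Fin d → ℝ) :
    (Kr d a x : ℂ) = ∑' l, (a l : ℂ) * torusChar d l x := by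
  rw [Kr, Complex.conj_eq_iff_re.1 (conj_Kc hev x), Kc_eq]

theorem Kr_neg (hev : ∀ l, a (-l) = a l) (x : Fin d → ℝ) : Kr d a (-x) = Kr d a x := by
  have : (Kr d a (-x) : ℂ) = Kr d a x := by
    rw [ofReal_Kr hev, ofReal_Kr hev, ← (Equiv.neg (Fin d → ℤ)).tsum_eq]
    refine tsum_congr fun l => ?_
    rw [Equiv.neg_apply, hev, torusChar_neg_right, neg_neg]
  exact_mod_cast this

theorem continuous_Kr (ha : Summable fun l => |a l|) : Continuous (Kr d a) := by
  refine Complex.continuous_re.comp ?_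
  change Continuous fun x => ∑' l, (a l : ℂ) * torusChar d l x
  refine continuous_tsum (fun l => continuous_const.mul (continuous_torusChar d l)) ha ?_
  intro l x
  rw [norm_mul, norm_torusChar, mul_one, Complex.norm_real, Real.norm_eq_abs]

theorem Nn_pos (d : ℕ) (hn : 1 ≤ n) : 0 < Nn d (fun _ => n) :=
  Finset.prod_pos fun _ _ => by positivity

open Classical in
/-- The part of the kernel carried by the frequencies congruent to `l` modulo `2 n`. -/
def aliasSum (d n : ℕ) (a : (Fin d → ℤ) → ℝ) (l : Fin d → ℤ) (x : Fin d → ℝ) : ℂ :=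
  ∑' m, if GridCongr d n l m then (a m : ℂ) * torusChar d m x else 0

theorem lam_eq_aliasSum (hn : 1 ≤ n) (ha : Summable fun l => |a l|) (hev : ∀ l, a (-l) = a l)
    (l : Fin d → ℤ) (x : Fin d → ℝ) :
    lam d (fun _ => n) (Kr d a) l x = Nn d (fun _ => n) * aliasSum d n a l x := by
  classical
  have h1 : ∀ k, HasSum (fun m => torusChar d l (knot d (fun _ => n) k) *
      ((a m : ℂ) * torusChar d m (x - knot d (fun _ => n) k)))
      (torusChar d l (knot d (fun _ => n) k) * (Kr d a (x - knot d (fun _ => n) k) : ℂ)) := by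
    intro k
    rw [ofReal_Kr hev]
    exact (summable_mul_torusChar ha _).hasSum.mul_left _
  have h2 := (hasSum_sum (s := Omega d (fun _ => n)) fun k _ => h1 k).tsum_eq
  change ∑ k ∈ Omega d (fun _ => n), torusChar d l (knot d (fun _ => n) k) *
    (Kr d a (x - knot d (fun _ => n) k) : ℂ) = _
  rw [← h2, aliasSum, ← tsum_mul_left]
  refine tsum_congr fun m => ?_
  have h3 := sum_torusChar_knot hn l m
  calc _ = ((a m : ℂ) * torusChar d m x) * ∑ k ∈ Omega d (fun _ => n),
        torusChar d (l - m) (knot d (fun _ => n) k) := by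
        rw [Finset.mul_sum]
        refine Finset.sum_congr rfl fun k _ => ?_
        rw [torusChar_sub_right, sub_eq_add_neg, torusChar_add_left]
        ring
    _ = _ := by
      rw [h3]
      split_ifs <;> ring

theorem lam_sub_knot (hn : 1 ≤ n) (ha : Summable fun l => |a l|) (hev : ∀ l, a (-l) = a l)
    (l : Fin d → ℤ) (x : Fin d → ℝ) (k : Fin d → ℤ) :
    lam d (fun _ => n) (Kr d a) l (x - knot d (fun _ => n) k) =
      torusChar d (-l) (knot d (fun _ => n) k) * lam d (fun _ => n) (Kr d a) l x := by
  rw [lam_eq_aliasSum hn ha hev, lam_eq_aliasSum hn ha hev, mul_left_comm]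
  congr 1
  rw [aliasSum, aliasSum, ← tsum_mul_left]
  refine tsum_congr fun m => ?_
  split_ifs with h
  · rw [torusChar_sub_right, torusChar_knot_of_gridCongr hn h.symm.neg]
    ring
  · rw [mul_zero]

theorem conj_lam (K : (Fin d → ℝ) → ℝ) (l : Fin d → ℤ) (x : Fin d → ℝ) :
    (starRingEnd ℂ) (lam d (fun _ => n) K l x) = lam d (fun _ => n) K (-l) x := by
  change (starRingEnd ℂ) (∑ k ∈ Omega d (fun _ => n), torusChar d l (knot d (fun _ => n) k) *
    (K (x - knot d (fun _ => n) k) : ℂ)) = ∑ k ∈ Omega d (fun _ => n),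
    torusChar d (-l) (knot d (fun _ => n) k) * (K (x - knot d (fun _ => n) k) : ℂ)
  simp only [map_sum, map_mul, Complex.conj_ofReal, torusChar_neg_left]

theorem lam_of_gridCongr (hn : 1 ≤ n) (K : (Fin d → ℝ) → ℝ) {l m : Fin d → ℤ}
    (h : GridCongr d n l m) (x : Fin d → ℝ) :
    lam d (fun _ => n) K l x = lam d (fun _ => n) K m x := by
  refine Finset.sum_congr rfl fun k _ => ?_
  exact congrArg (· * _) (torusChar_knot_of_gridCongr hn h k)

theorem ofReal_rho (K : (Fin d → ℝ) → ℝ) (l : Fin d → ℤ) (x : Fin d → ℝ) :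
    (rho d (fun _ => n) K l x : ℂ) =
      (lam d (fun _ => n) K l x + lam d (fun _ => n) K (-l) x) / Nn d (fun _ => n) := by
  rw [rho, ← conj_lam, Complex.add_conj]
  push_cast
  ring

theorem rho_of_gridCongr (hn : 1 ≤ n) (K : (Fin d → ℝ) → ℝ) {l m : Fin d → ℤ}
    (h : GridCongr d n l m) (x : Fin d → ℝ) :
    rho d (fun _ => n) K l x = rho d (fun _ => n) K m x := by
  rw [rho, rho, lam_of_gridCongr hn K h]

theorem rho_neg (K : (Fin d → ℝ) → ℝ) (l : Fin d → ℤ) (x : Fin d → ℝ) :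
    rho d (fun _ => n) K (-l) x = rho d (fun _ => n) K l x := by
  rw [rho, rho, ← conj_lam, Complex.conj_re]

open Classical in
theorem sum_torusChar_mul_rho (hn : 1 ≤ n) (ha : Summable fun l => |a l|)
    (hev : ∀ l, a (-l) = a l) (l j : Fin d → ℤ) (x : Fin d → ℝ) :
    ∑ k ∈ Omega d (fun _ => n), torusChar d l (knot d (fun _ => n) k) *
      (rho d (fun _ => n) (Kr d a) j (x - knot d (fun _ => n) k) : ℂ) =
    lam d (fun _ => n) (Kr d a) l x *
      ((if GridCongr d n l j then 1 else 0) + if GridCongr d n (-l) j then 1 else 0) := by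
  have hN : (Nn d (fun _ => n) : ℂ) ≠ 0 := by exact_mod_cast (Nn_pos d hn).ne'
  have h1 := sum_torusChar_knot hn l j
  have h2 := sum_torusChar_knot hn l (-j)
  calc _ = (lam d (fun _ => n) (Kr d a) j x / Nn d (fun _ => n)) *
        ∑ k ∈ Omega d (fun _ => n), torusChar d (l - j) (knot d (fun _ => n) k) +
        (lam d (fun _ => n) (Kr d a) (-j) x / Nn d (fun _ => n)) *
        ∑ k ∈ Omega d (fun _ => n), torusChar d (l - -j) (knot d (fun _ => n) k) := by
        rw [Finset.mul_sum, Finset.mul_sum, ← Finset.sum_add_distrib]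
        refine Finset.sum_congr rfl fun k _ => ?_
        rw [ofReal_rho, lam_sub_knot hn ha hev, lam_sub_knot hn ha hev, sub_eq_add_neg,
          sub_eq_add_neg, torusChar_add_left, torusChar_add_left]
        ring
    _ = _ := by
      rw [h1, h2]
      simp only [gridCongr_neg_right]
      have e1 : GridCongr d n l j → lam d (fun _ => n) (Kr d a) j x =
        lam d (fun _ => n) (Kr d a) l x := fun h => (lam_of_gridCongr hn _ h x).symm
      have e2 : GridCongr d n (-l) j → lam d (fun _ => n) (Kr d a) (-j) x =
        lam d (fun _ => n) (Kr d a) l x := fun h =>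
          (lam_of_gridCongr hn _ (gridCongr_neg_right.2 h) x).symm
      split_ifs with g1 g2 g2
      · rw [e1 g1, e2 g2]; field_simp
      · rw [e1 g1]; field_simp; ring
      · rw [e2 g2]; field_simp; ring
      · ring

open Classical in
/-- The interpolating sk-spline of a character. -/
theorem sum_torusChar_mul_fundSk (hn : 1 ≤ n) (ha : Summable fun l => |a l|)
    (hev : ∀ l, a (-l) = a l) (l : Fin d → ℤ) (x : Fin d → ℝ) :
    ∑ k ∈ Omega d (fun _ => n), torusChar d l (knot d (fun _ => n) k) *
      (fundSk d (fun _ => n) (Kr d a) (x - knot d (fun _ => n) k) : ℂ) =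
    if GridCongr d n l 0 then 1 else
      2 * lam d (fun _ => n) (Kr d a) l x /
        (Nn d (fun _ => n) * rho d (fun _ => n) (Kr d a) l 0) := by
  have hN : (Nn d (fun _ => n) : ℂ) ≠ 0 := by exact_mod_cast (Nn_pos d hn).ne'
  have h0 := sum_torusChar_knot hn l 0
  rw [sub_zero] at h0
  have h1 := sum_OmegaStar_gridCongr hn l
  have h2 := sum_OmegaStar_gridCongr hn (-l)
  have hl : GridCongr d n (-l) 0 ↔ GridCongr d n l 0 := by
    rw [← gridCongr_neg_right, neg_zero]
  rw [hl] at h2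
  calc _ = (∑ k ∈ Omega d (fun _ => n), torusChar d l (knot d (fun _ => n) k)) /
        Nn d (fun _ => n) + (∑ j ∈ OmegaStar d (fun _ => n),
        (∑ k ∈ Omega d (fun _ => n), torusChar d l (knot d (fun _ => n) k) *
          (rho d (fun _ => n) (Kr d a) j (x - knot d (fun _ => n) k) : ℂ)) /
          rho d (fun _ => n) (Kr d a) j 0) / Nn d (fun _ => n) := by
        simp only [Finset.sum_div]
        rw [Finset.sum_comm, ← Finset.sum_add_distrib]
        refine Finset.sum_congr rfl fun k _ => ?_
        rw [fundSk]
        push_cast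
        rw [mul_add, mul_left_comm, Finset.mul_sum, Finset.mul_sum]
        congr 1
        · ring
        · refine Finset.sum_congr rfl fun j _ => ?_
          ring
    _ = (if GridCongr d n l 0 then 1 else 0) + (∑ j ∈ OmegaStar d (fun _ => n),
        (lam d (fun _ => n) (Kr d a) l x / rho d (fun _ => n) (Kr d a) l 0) *
        ((if GridCongr d n l j then 1 else 0) + if GridCongr d n (-l) j then 1 else 0)) /
          Nn d (fun _ => n) := by
        rw [h0]
        congr 1
        · split_ifs
          · exact div_self hN
          · exact zero_div _
        · congr 1
          refine Finset.sum_congr rfl fun j _ => ?_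
          rw [sum_torusChar_mul_rho hn ha hev]
          have e1 : GridCongr d n l j → rho d (fun _ => n) (Kr d a) j 0 =
            rho d (fun _ => n) (Kr d a) l 0 := fun h => (rho_of_gridCongr hn _ h 0).symm
          have e2 : GridCongr d n (-l) j → rho d (fun _ => n) (Kr d a) j 0 =
            rho d (fun _ => n) (Kr d a) l 0 := fun h => by
              rw [← rho_of_gridCongr hn _ h 0, rho_neg]
          split_ifs with g1 g2 g2
          · rw [e1 g1]; ring
          · rw [e1 g1]; ring
          · rw [e2 g2]; ring
          · ring
    _ = _ := by
      rw [← Finset.mul_sum, Finset.sum_add_distrib, h1, h2]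
      split_ifs
      · ring
      · rw [zero_add, mul_comm (Nn d (fun _ => n) : ℂ), ← div_div]
        ring

end Kernel

section ErrorKernel

variable {d n : ℕ} {a : (Fin d → ℤ) → ℝ}

/-- The kernel of the error operator `f ↦ f - sk_n(f,·)` on `f = K * φ`. -/
def errKernel (d n : ℕ) (K : (Fin d → ℝ) → ℝ) (x y : Fin d → ℝ) : ℝ :=
  K (x - y) - ∑ k ∈ Omega d (fun _ => n), K (knot d (fun _ => n) k - y) *
    fundSk d (fun _ => n) K (x - knot d (fun _ => n) k)

/-- The Fourier coefficients of the error kernel in its second variable. -/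
def errCoeff (d n : ℕ) (a : (Fin d → ℤ) → ℝ) (l : Fin d → ℤ) (x : Fin d → ℝ) : ℂ :=
  (a l : ℂ) * (torusChar d l x - ∑ k ∈ Omega d (fun _ => n),
    torusChar d l (knot d (fun _ => n) k) *
      (fundSk d (fun _ => n) (Kr d a) (x - knot d (fun _ => n) k) : ℂ))

theorem hasSum_errKernel (ha : Summable fun l => |a l|) (hev : ∀ l, a (-l) = a l)
    (x y : Fin d → ℝ) :
    HasSum (fun l => errCoeff d n a l x * torusChar d l (-y))
      (errKernel d n (Kr d a) x y : ℂ) := by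
  have h1 : ∀ z, HasSum (fun l => (a l : ℂ) * torusChar d l (z - y)) (Kr d a (z - y) : ℂ) := by
    intro z
    rw [ofReal_Kr hev]
    exact (summable_mul_torusChar ha _).hasSum
  have h2 := (h1 x).sub (hasSum_sum (s := Omega d (fun _ => n)) fun k _ =>
    (h1 (knot d (fun _ => n) k)).mul_right
      (fundSk d (fun _ => n) (Kr d a) (x - knot d (fun _ => n) k) : ℂ))
  rw [errKernel]
  push_cast
  refine HasSum.congr_fun h2 fun l => ?_
  simp only [errCoeff, sub_eq_add_neg _ y, torusChar_add_right]
  rw [mul_sub, sub_mul, Finset.mul_sum, Finset.sum_mul]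
  congr 1
  · ring
  · exact Finset.sum_congr rfl fun k _ => by ring

open Classical in
/-- The total mass of the coefficients at frequencies congruent to `l`. -/
def aliasMass (d n : ℕ) (a : (Fin d → ℤ) → ℝ) (l : Fin d → ℤ) : ℝ :=
  ∑' m, if GridCongr d n l m then a m else 0

open Classical in
/-- The mass of the coefficients at frequencies congruent to, but different from, `l`. -/
def aliasTail (d n : ℕ) (a : (Fin d → ℤ) → ℝ) (l : Fin d → ℤ) : ℝ :=
  ∑' m, if GridCongr d n l m ∧ m ≠ l then a m else 0

theorem summable_ite_of_abs (ha : Summable fun l => |a l|) (p : (Fin d → ℤ) → Prop)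
    [DecidablePred p] : Summable fun m => if p m then a m else 0 := by
  refine Summable.of_norm_bounded ha fun m => ?_
  split_ifs
  · exact le_rfl
  · simp

theorem aliasMass_eq (ha : Summable fun l => |a l|) (l : Fin d → ℤ) :
    aliasMass d n a l = a l + aliasTail d n a l := by
  classical
  rw [aliasMass, (summable_ite_of_abs ha _).tsum_eq_add_tsum_ite l, aliasTail,
    if_pos (GridCongr.refl d n l)]
  congr 1
  refine tsum_congr fun m => ?_
  by_cases h : m = l <;> simp [h]

theorem aliasTail_nonneg (hnn : ∀ l, 0 ≤ a l) (l : Fin d → ℤ) : 0 ≤ aliasTail d n a l := by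
  classical
  exact tsum_nonneg fun m => by split_ifs <;> simp [hnn]

theorem le_aliasMass (ha : Summable fun l => |a l|) (hnn : ∀ l, 0 ≤ a l) (l : Fin d → ℤ) :
    a l ≤ aliasMass d n a l := by
  rw [aliasMass_eq ha]
  exact le_add_of_nonneg_right (aliasTail_nonneg hnn l)

theorem aliasSum_zero (l : Fin d → ℤ) : aliasSum d n a l 0 = aliasMass d n a l := by
  rw [aliasSum, aliasMass, Complex.ofReal_tsum]
  refine tsum_congr fun m => ?_
  rw [torusChar_zero_right, mul_one]
  split_ifs <;> simp

theorem norm_aliasSum_le (ha : Summable fun l => |a l|) (hnn : ∀ l, 0 ≤ a l) (l : Fin d → ℤ)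
    (x : Fin d → ℝ) : ‖aliasSum d n a l x‖ ≤ aliasMass d n a l := by
  classical
  refine tsum_of_norm_bounded (summable_ite_of_abs ha _).hasSum fun m => ?_
  split_ifs
  · rw [norm_mul, norm_torusChar, mul_one, Complex.norm_real, Real.norm_of_nonneg (hnn m)]
  · simp

theorem norm_aliasMass_mul_sub_le (ha : Summable fun l => |a l|) (hnn : ∀ l, 0 ≤ a l)
    (l : Fin d → ℤ) (x : Fin d → ℝ) :
    ‖aliasMass d n a l * torusChar d l x - aliasSum d n a l x‖ ≤ 2 * aliasTail d n a l := by
  classical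
  have h1 : HasSum (fun m => if GridCongr d n l m then (a m : ℂ) * torusChar d m x else 0)
      (aliasSum d n a l x) := by
    refine Summable.hasSum (Summable.of_norm_bounded ha fun m => ?_)
    split_ifs
    · rw [norm_mul, norm_torusChar, mul_one, Complex.norm_real, Real.norm_eq_abs]
    · simp
  have h2 := ((Complex.hasSum_ofReal.2
    (summable_ite_of_abs ha (GridCongr d n l)).hasSum).mul_right (torusChar d l x)).sub h1
  change HasSum _ (aliasMass d n a l * torusChar d l x - aliasSum d n a l x) at h2
  rw [← h2.tsum_eq]
  refine tsum_of_norm_bounded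
    ((summable_ite_of_abs ha fun m => GridCongr d n l m ∧ m ≠ l).hasSum.mul_left 2) fun m => ?_
  by_cases hm : GridCongr d n l m
  · by_cases hml : m = l
    · subst hml; simp [hm]
    · simp only [hm, hml, if_true, ne_eq, not_false_eq_true, and_self]
      rw [← mul_sub, norm_mul, Complex.norm_real, Real.norm_of_nonneg (hnn m), mul_comm]
      refine mul_le_mul_of_nonneg_right ((norm_sub_le _ _).trans ?_) (hnn m)
      rw [norm_torusChar, norm_torusChar]; norm_num
  · simp [hm]

theorem errCoeff_of_not_gridCongr (hn : 1 ≤ n) (ha : Summable fun l => |a l|)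
    (hev : ∀ l, a (-l) = a l) {l : Fin d → ℤ} (hl : ¬ GridCongr d n l 0) (x : Fin d → ℝ) :
    errCoeff d n a l x =
      (a l : ℂ) * (torusChar d l x - aliasSum d n a l x / aliasMass d n a l) := by
  have hN : (Nn d (fun _ => n) : ℂ) ≠ 0 := by exact_mod_cast (Nn_pos d hn).ne'
  have hrho : (rho d (fun _ => n) (Kr d a) l 0 : ℂ) = 2 * aliasMass d n a l := by
    rw [rho, lam_eq_aliasSum hn ha hev, aliasSum_zero, ← Complex.ofReal_mul, Complex.ofReal_re]
    push_cast
    field_simp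
  rw [errCoeff, sum_torusChar_mul_fundSk hn ha hev, if_neg hl, hrho, lam_eq_aliasSum hn ha hev]
  congr 2
  rw [mul_left_comm (Nn d (fun _ => n) : ℂ), mul_div_mul_left _ _ two_ne_zero,
    mul_div_mul_left _ _ hN]

theorem norm_errCoeff_le (hn : 1 ≤ n) (ha : Summable fun l => |a l|) (hnn : ∀ l, 0 ≤ a l)
    (hev : ∀ l, a (-l) = a l) (l : Fin d → ℤ) (x : Fin d → ℝ) :
    ‖errCoeff d n a l x‖ ≤ 2 * a l := by
  by_cases hl : GridCongr d n l 0
  · rw [errCoeff, sum_torusChar_mul_fundSk hn ha hev, if_pos hl, norm_mul, Complex.norm_real,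
      Real.norm_of_nonneg (hnn l), mul_comm]
    refine mul_le_mul_of_nonneg_right ((norm_sub_le _ _).trans ?_) (hnn l)
    rw [norm_torusChar, norm_one]; norm_num
  · rw [errCoeff_of_not_gridCongr hn ha hev hl, norm_mul, Complex.norm_real,
      Real.norm_of_nonneg (hnn l), mul_comm]
    refine mul_le_mul_of_nonneg_right ((norm_sub_le _ _).trans ?_) (hnn l)
    have h0 : 0 ≤ aliasMass d n a l := (hnn l).trans (le_aliasMass ha hnn l)
    have : ‖aliasSum d n a l x / aliasMass d n a l‖ ≤ 1 := by
      rw [norm_div, Complex.norm_real, Real.norm_of_nonneg h0]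
      exact div_le_one_of_le₀ (norm_aliasSum_le ha hnn l x) h0
    rw [norm_torusChar]; linarith

theorem norm_errCoeff_le_aliasTail (hn : 1 ≤ n) (ha : Summable fun l => |a l|)
    (hnn : ∀ l, 0 ≤ a l) (hev : ∀ l, a (-l) = a l) {l : Fin d → ℤ}
    (hl : ¬ GridCongr d n l 0) (x : Fin d → ℝ) :
    ‖errCoeff d n a l x‖ ≤ 2 * aliasTail d n a l := by
  have hle := le_aliasMass (n := n) ha hnn l
  rcases (hnn l).eq_or_lt with h0 | h0
  · rw [errCoeff, ← h0]
    simpa using aliasTail_nonneg hnn l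
  · have hpos : 0 < aliasMass d n a l := h0.trans_le hle
    have hne : (aliasMass d n a l : ℂ) ≠ 0 := by exact_mod_cast hpos.ne'
    have : errCoeff d n a l x = ((a l / aliasMass d n a l : ℝ) : ℂ) *
        (aliasMass d n a l * torusChar d l x - aliasSum d n a l x) := by
      rw [errCoeff_of_not_gridCongr hn ha hev hl]
      push_cast
      field_simp
    rw [this, norm_mul, Complex.norm_real, Real.norm_of_nonneg (div_nonneg h0.le hpos.le)]
    exact (mul_le_of_le_one_left (norm_nonneg _) (div_le_one_of_le₀ hle hpos.le)).trans
      (norm_aliasMass_mul_sub_le ha hnn l x)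

theorem errKernel_sub_swap (hn : 1 ≤ n) (ha : Summable fun l => |a l|)
    (hev : ∀ l, a (-l) = a l) (x y : Fin d → ℝ) :
    errKernel d n (Kr d a) x y - errKernel d n (Kr d a) y x =
      (aliasSum d n a 0 x).re - (aliasSum d n a 0 y).re := by
  have hN := (Nn_pos d hn).ne'
  have hsymm : ∀ u v, Kr d a (u - v) = Kr d a (v - u) := fun u v => by
    rw [← Kr_neg hev, neg_sub]
  have hmean : ∀ y, ∑ k ∈ Omega d (fun _ => n), Kr d a (knot d (fun _ => n) k - y) =
      Nn d (fun _ => n) * (aliasSum d n a 0 y).re := by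
    intro y
    have h1 := lam_eq_aliasSum hn ha hev 0 y
    have h2 : lam d (fun _ => n) (Kr d a) 0 y =
        ((∑ k ∈ Omega d (fun _ => n), Kr d a (knot d (fun _ => n) k - y) : ℝ) : ℂ) := by
      rw [Complex.ofReal_sum]
      refine Finset.sum_congr rfl fun k _ => ?_
      rw [hsymm]
      exact (congrArg (· * _) (torusChar_zero_left d _)).trans (one_mul _)
    rw [h2] at h1
    have := congrArg Complex.re h1
    rwa [Complex.ofReal_re, Complex.re_ofReal_mul] at this
  have hpair : ∀ j x y, ∑ k ∈ Omega d (fun _ => n), Kr d a (knot d (fun _ => n) k - y) *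
      rho d (fun _ => n) (Kr d a) j (x - knot d (fun _ => n) k) =
      2 / Nn d (fun _ => n) * ((starRingEnd ℂ) (lam d (fun _ => n) (Kr d a) j y) *
        lam d (fun _ => n) (Kr d a) j x).re := by
    intro j x y
    rw [conj_lam]
    change _ = 2 / Nn d (fun _ => n) * ((∑ k ∈ Omega d (fun _ => n),
      torusChar d (-j) (knot d (fun _ => n) k) * (Kr d a (y - knot d (fun _ => n) k) : ℂ)) *
        lam d (fun _ => n) (Kr d a) j x).re
    rw [Finset.sum_mul, Complex.re_sum, Finset.mul_sum]
    refine Finset.sum_congr rfl fun k _ => ?_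
    rw [rho, lam_sub_knot hn ha hev, hsymm, mul_right_comm, mul_comm _ (Kr d a _ : ℂ),
      Complex.re_ofReal_mul]
    ring
  have hformula : ∀ x y, errKernel d n (Kr d a) x y = Kr d a (x - y) -
      (aliasSum d n a 0 y).re - 1 / Nn d (fun _ => n) * ∑ j ∈ OmegaStar d (fun _ => n),
        2 / Nn d (fun _ => n) * ((starRingEnd ℂ) (lam d (fun _ => n) (Kr d a) j y) *
        lam d (fun _ => n) (Kr d a) j x).re / rho d (fun _ => n) (Kr d a) j 0 := by
    intro x y
    have h1 : (aliasSum d n a 0 y).re = 1 / Nn d (fun _ => n) *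
        ∑ k ∈ Omega d (fun _ => n), Kr d a (knot d (fun _ => n) k - y) := by
      rw [hmean]; field_simp
    rw [h1, errKernel, sub_sub]
    congr 1
    simp only [← hpair, Finset.sum_div]
    rw [Finset.sum_comm, Finset.mul_sum, Finset.mul_sum, ← Finset.sum_add_distrib]
    refine Finset.sum_congr rfl fun k _ => ?_
    rw [fundSk, mul_add, mul_comm (Kr d a _) (1 / Nn d _), mul_left_comm, Finset.mul_sum]
    congr 2
    exact Finset.sum_congr rfl fun j _ => by ring
  have hre : ∀ u v : ℂ, ((starRingEnd ℂ) u * v).re = ((starRingEnd ℂ) v * u).re := by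
    intro u v
    simp; ring
  rw [hformula x y, hformula y x, hsymm y x]
  simp only [hre (lam d (fun _ => n) (Kr d a) _ x)]
  ring

end ErrorKernel

section Decay

variable {d n : ℕ} {γ : ℝ} {a : (Fin d → ℤ) → ℝ}

theorem one_le_norm_of_ne_zero {l : Fin d → ℤ} (hl : l ≠ 0) : 1 ≤ ‖l‖ := by
  obtain ⟨i, hi⟩ := Function.ne_iff.1 hl
  have h1 : ‖l i‖ ≤ ‖l‖ := norm_le_pi_norm l i
  rw [Int.norm_eq_abs] at h1
  have h2 : (1 : ℤ) ≤ |l i| := Int.one_le_abs hi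
  have h3 : (1 : ℝ) ≤ |(l i : ℝ)| := by exact_mod_cast h2
  exact h3.trans h1

theorem truncWeight_of_le {l : Fin d → ℤ} (h : (n : ℝ) ≤ ‖l‖) :
    truncWeight d n γ l = ‖l‖ ^ (-γ) := by
  rw [truncWeight, max_eq_right h]

theorem summable_abs_of_le_norm_rpow (hγ : (d : ℝ) < γ) (hnn : ∀ l, 0 ≤ a l) (h0 : a 0 = 0)
    (hle : ∀ l, l ≠ 0 → a l ≤ ‖l‖ ^ (-γ)) : Summable fun l => |a l| := by
  refine Summable.of_nonneg_of_le (fun _ => abs_nonneg _) (fun l => ?_)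
    (summable_truncWeight le_rfl hγ).1
  rw [abs_of_nonneg (hnn l)]
  by_cases hl : l = 0
  · rw [hl, h0]; exact truncWeight_nonneg _ _ _ _
  · rw [truncWeight_of_le (by simpa using one_le_norm_of_ne_zero hl)]
    exact hle l hl

theorem aliasTail_le (hn : 1 ≤ n) (hγ : (d : ℝ) < γ) (hnn : ∀ l, 0 ≤ a l)
    (hle : ∀ l, l ≠ 0 → a l ≤ ‖l‖ ^ (-γ)) {l : Fin d → ℤ} (hl : ‖l‖ < n) :
    aliasTail d n a l ≤ 2 ^ γ * (∑' m : Fin d → ℤ, (1 + ‖m‖) ^ (-γ)) * (n : ℝ) ^ (-γ) := by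
  classical
  have hγ0 : 0 ≤ γ := (Nat.cast_nonneg d).trans hγ.le
  have hli : ∀ i, |l i| < n := fun i => by
    have h1 : ‖l i‖ < n := (norm_le_pi_norm l i).trans_lt hl
    rw [Int.norm_eq_abs] at h1
    exact_mod_cast h1
  let g : (Fin d → ℤ) → (Fin d → ℤ) := fun c i => l i + 2 * (n : ℤ) * c i
  have hinj : Function.Injective g := fun c c' h => by
    funext i
    have h1 : l i + 2 * (n : ℤ) * c i = l i + 2 * (n : ℤ) * c' i := congrFun h i
    have h2 : (2 * (n : ℤ)) ≠ 0 := by positivity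
    exact mul_left_cancel₀ h2 (add_left_cancel h1)
  have hsupp : Function.support (fun m => if GridCongr d n l m ∧ m ≠ l then a m else 0) ⊆
      Set.range g := by
    intro m hm
    have hm' : GridCongr d n l m := by
      by_contra h
      exact hm (by simp [h])
    choose c hc using hm'.symm
    exact ⟨c, by funext i; simp only [g]; linarith [hc i]⟩
  have hbound : ∀ c, (if GridCongr d n l (g c) ∧ g c ≠ l then a (g c) else 0) ≤
      2 ^ γ * (n : ℝ) ^ (-γ) * (1 + ‖c‖) ^ (-γ) := by
    intro c
    split_ifs with h
    · have hc : ∃ i, c i ≠ 0 := by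
        by_contra! hc
        exact h.2 (by funext i; simp [g, hc i])
      obtain ⟨i, hi⟩ := hc
      have habs : ∀ i, 2 * (n : ℤ) * |c i| ≤ |g c i| + |l i| := fun i => by
        have h1 : |2 * (n : ℤ) * c i| = 2 * n * |c i| := by
          rw [abs_mul, abs_of_nonneg (by positivity : (0:ℤ) ≤ 2 * n)]
        have h2 : 2 * (n : ℤ) * c i = g c i - l i := by simp [g]
        rw [← h1, h2]
        exact abs_sub _ _
      have hge : (n : ℝ) ≤ ‖g c‖ := by
        have h1 : (n : ℤ) ≤ |g c i| := by
          have := habs i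
          have h2 : (1 : ℤ) ≤ |c i| := Int.one_le_abs hi
          have h3 := hli i
          nlinarith
        have h2 : (n : ℝ) ≤ |(g c i : ℝ)| := by exact_mod_cast h1
        refine h2.trans ?_
        rw [← Int.norm_eq_abs]
        exact norm_le_pi_norm (g c) i
      have hne : g c ≠ 0 := fun h0 => by
        rw [h0, norm_zero] at hge
        have : (1 : ℝ) ≤ n := by exact_mod_cast hn
        linarith
      refine (hle _ hne).trans ?_
      rw [← truncWeight_of_le hge]
      refine truncWeight_add_le hn hγ0 _ _ fun i => (habs i).trans ?_
      have := hli i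
      have h3 : (0 : ℤ) ≤ n := by positivity
      linarith
    · positivity
  have hS := (summable_one_add_norm_rpow d hγ).mul_left (2 ^ γ * (n : ℝ) ^ (-γ))
  rw [aliasTail, ← hinj.tsum_eq hsupp]
  refine (Summable.tsum_le_tsum hbound (Summable.of_nonneg_of_le (fun c => ?_) hbound hS)
    hS).trans_eq ?_
  · split_ifs <;> simp [hnn]
  · rw [tsum_mul_left]; ring

theorem not_gridCongr_zero {l : Fin d → ℤ} (hl : ‖l‖ < n) (h0 : l ≠ 0) :
    ¬ GridCongr d n l 0 := by
  intro h
  apply h0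
  funext i
  have h1 : ‖l i‖ < n := (norm_le_pi_norm l i).trans_lt hl
  rw [Int.norm_eq_abs] at h1
  have h2 : |l i| < n := by exact_mod_cast h1
  have h3 := h i
  rw [Pi.zero_apply, sub_zero] at h3
  exact Int.eq_zero_of_abs_lt_dvd h3 (by have := abs_nonneg (l i); linarith)

theorem norm_errCoeff_le_truncWeight (hn : 1 ≤ n) (hγ : (d : ℝ) < γ) (hnn : ∀ l, 0 ≤ a l)
    (hev : ∀ l, a (-l) = a l) (h0 : a 0 = 0) (hle : ∀ l, l ≠ 0 → a l ≤ ‖l‖ ^ (-γ))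
    (l : Fin d → ℤ) (x : Fin d → ℝ) :
    ‖errCoeff d n a l x‖ ≤
      (2 + 2 * (2 ^ γ * ∑' m : Fin d → ℤ, (1 + ‖m‖) ^ (-γ))) * truncWeight d n γ l := by
  have ha := summable_abs_of_le_norm_rpow hγ hnn h0 hle
  have hS : 0 ≤ ∑' m : Fin d → ℤ, (1 + ‖m‖) ^ (-γ) := tsum_nonneg fun m => by positivity
  have hS' : 0 ≤ 2 ^ γ * ∑' m : Fin d → ℤ, (1 + ‖m‖) ^ (-γ) := by positivity
  have hw := truncWeight_nonneg d n γ l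
  rcases lt_or_ge ‖l‖ n with h | h
  · by_cases hl : l = 0
    · rw [hl, errCoeff, h0]
      simp only [Complex.ofReal_zero, zero_mul, norm_zero]
      exact mul_nonneg (by positivity) (truncWeight_nonneg _ _ _ _)
    · have h1 := norm_errCoeff_le_aliasTail hn ha hnn hev (not_gridCongr_zero h hl) x
      have h2 := aliasTail_le hn hγ hnn hle h
      have h3 : truncWeight d n γ l = (n : ℝ) ^ (-γ) := by
        rw [truncWeight, max_eq_left h.le]
      rw [← h3] at h2
      linarith
  · have hl : l ≠ 0 := fun hl => by
      rw [hl, norm_zero] at h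
      have : (1 : ℝ) ≤ n := by exact_mod_cast hn
      linarith
    have h1 := norm_errCoeff_le hn ha hnn hev l x
    have h2 := hle l hl
    rw [← truncWeight_of_le h] at h2
    have := mul_nonneg hS' hw
    linarith

theorem norm_aliasSum_zero_le (hn : 1 ≤ n) (hγ : (d : ℝ) < γ) (hnn : ∀ l, 0 ≤ a l)
    (h0 : a 0 = 0) (hle : ∀ l, l ≠ 0 → a l ≤ ‖l‖ ^ (-γ)) (x : Fin d → ℝ) :
    ‖aliasSum d n a 0 x‖ ≤
      2 ^ γ * (∑' m : Fin d → ℤ, (1 + ‖m‖) ^ (-γ)) * (n : ℝ) ^ (-γ) := by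
  have ha := summable_abs_of_le_norm_rpow hγ hnn h0 hle
  refine (norm_aliasSum_le ha hnn 0 x).trans ?_
  rw [aliasMass_eq ha, h0, zero_add]
  exact aliasTail_le hn hγ hnn hle (by rw [norm_zero]; exact_mod_cast hn)

end Decay

section Gamma

variable {d : ℕ} {γ : ℝ} {nrm : (Fin d → ℝ) → ℝ}

theorem norm_le_of_eq_sqrt_or_eq_norm
    (hnrm : (∀ x, nrm x = Real.sqrt (∑ i, x i ^ 2)) ∨ (∀ x, nrm x = ‖x‖)) (x : Fin d → ℝ) :
    ‖x‖ ≤ nrm x := by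
  rcases hnrm with h | h
  · rw [h, pi_norm_le_iff_of_nonneg (Real.sqrt_nonneg _)]
    intro i
    exact Real.abs_le_sqrt (Finset.single_le_sum (f := fun i => x i ^ 2)
      (fun i _ => sq_nonneg _) (Finset.mem_univ i))
  · exact (h x).ge

theorem aGamma_neg
    (hnrm : (∀ x, nrm x = Real.sqrt (∑ i, x i ^ 2)) ∨ (∀ x, nrm x = ‖x‖)) (l : Fin d → ℤ) :
    aGamma d γ nrm (-l) = aGamma d γ nrm l := by
  have h : nrm (fun i => (((-l) i : ℤ) : ℝ)) = nrm fun i => (l i : ℝ) := by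
    rcases hnrm with h | h
    · simp [h]
    · rw [h, h, ← norm_neg]
      congr 1
      funext i
      simp
  simp only [aGamma, neg_eq_zero, h]

theorem aGamma_nonneg
    (hnrm : (∀ x, nrm x = Real.sqrt (∑ i, x i ^ 2)) ∨ (∀ x, nrm x = ‖x‖)) (l : Fin d → ℤ) :
    0 ≤ aGamma d γ nrm l := by
  unfold aGamma
  split_ifs
  · exact le_rfl
  · exact Real.rpow_nonneg ((norm_nonneg _).trans (norm_le_of_eq_sqrt_or_eq_norm hnrm _)) _

theorem norm_intCast_pi (l : Fin d → ℤ) : ‖fun i => (l i : ℝ)‖ = ‖l‖ := by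
  simp [Pi.norm_def]
  congr 1

theorem aGamma_le (hγ : 0 ≤ γ)
    (hnrm : (∀ x, nrm x = Real.sqrt (∑ i, x i ^ 2)) ∨ (∀ x, nrm x = ‖x‖)) (l : Fin d → ℤ)
    (hl : l ≠ 0) : aGamma d γ nrm l ≤ ‖l‖ ^ (-γ) := by
  rw [aGamma, if_neg hl]
  refine Real.rpow_le_rpow_of_nonpos (norm_pos_iff.2 hl) ?_ (by linarith)
  rw [← norm_intCast_pi]
  exact norm_le_of_eq_sqrt_or_eq_norm hnrm _

end Gamma

section Torus

variable {d : ℕ}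

theorem nu_eq_pi (d : ℕ) : nu d = (ENNReal.ofReal ((2 * π) ^ d))⁻¹ •
    Measure.pi fun _ : Fin d => (volume : Measure ℝ).restrict (Set.Ico 0 (2 * π)) := by
  rw [nu, volume_pi, Measure.restrict_pi_pi]

instance isProbabilityMeasure_nu (d : ℕ) : IsProbabilityMeasure (nu d) := by
  constructor
  have h2 : 0 < (2 * π) ^ d := by positivity
  rw [nu_eq_pi, Measure.smul_apply, Measure.pi_univ]
  simp only [Measure.restrict_apply_univ, Real.volume_Ico, sub_zero, Finset.prod_const,
    Finset.card_univ, Fintype.card_fin, smul_eq_mul]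
  rw [← ENNReal.ofReal_pow (by positivity)]
  exact ENNReal.inv_mul_cancel (by simpa using h2) ENNReal.ofReal_ne_top

theorem integral_torusChar {l : Fin d → ℤ} :
    ∫ y, torusChar d l y ∂(nu d) = if l = 0 then 1 else 0 := by
  split_ifs with h
  · subst h
    simp [torusChar_zero_left]
  · obtain ⟨i, hi⟩ := Function.ne_iff.1 h
    rw [nu_eq_pi, integral_smul_measure]
    simp only [torusChar_eq_prod]
    rw [integral_fintype_prod_eq_prod (𝕜 := ℂ)
      (fun i (t : ℝ) => Complex.exp (Complex.I * (((l i : ℝ) * t : ℝ) : ℂ)))]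
    rw [Finset.prod_eq_zero (Finset.mem_univ i), smul_zero]
    have hc : Complex.I * (l i : ℂ) ≠ 0 :=
      mul_ne_zero Complex.I_ne_zero (by exact_mod_cast hi)
    have h1 := integral_exp_mul_complex (a := 0) (b := 2 * π) hc
    rw [integral_Ico_eq_integral_Ioc, ← intervalIntegral.integral_of_le (by positivity)]
    have h2 : ∀ t : ℝ, Complex.I * (((l i : ℝ) * t : ℝ) : ℂ) = Complex.I * (l i : ℂ) * t := by
      intro t; push_cast; ring
    simp only [h2]
    rw [h1]
    have h3 : Complex.exp (Complex.I * (l i : ℂ) * ((2 * π : ℝ) : ℂ)) = 1 := by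
      rw [Complex.exp_eq_one_iff]
      exact ⟨l i, by push_cast; ring⟩
    rw [h3]
    simp

/-- Parseval's identity for an absolutely convergent trigonometric series. -/
theorem integral_normSq_of_hasSum {c : (Fin d → ℤ) → ℂ} (hc : Summable fun l => ‖c l‖)
    {f : (Fin d → ℝ) → ℂ} (hf : ∀ y, HasSum (fun l => c l * torusChar d l (-y)) (f y)) :
    ∫ y, ‖f y‖ ^ 2 ∂(nu d) = ∑' l, ‖c l‖ ^ 2 := by
  have hcont : ∀ l, Continuous fun y => c l * torusChar d l (-y) := fun l =>
    continuous_const.mul ((continuous_torusChar d l).comp continuous_neg)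
  have hfc : Continuous f := by
    have : f = fun y => ∑' l, c l * torusChar d l (-y) := funext fun y => (hf y).tsum_eq.symm
    rw [this]
    refine continuous_tsum hcont hc fun l y => ?_
    rw [norm_mul, norm_torusChar, mul_one]
  have hfb : ∀ y, ‖f y‖ ≤ ∑' l, ‖c l‖ := fun y => by
    rw [← (hf y).tsum_eq]
    exact tsum_of_norm_bounded hc.hasSum fun l => by rw [norm_mul, norm_torusChar, mul_one]
  have hint : ∀ {g : (Fin d → ℝ) → ℂ} (_ : Continuous g) (C : ℝ) (_ : ∀ y, ‖g y‖ ≤ C),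
      Integrable g (nu d) := fun hg C hC =>
    Integrable.of_bound hg.aestronglyMeasurable C (Filter.Eventually.of_forall hC)
  have hcoef : ∀ l, ∫ y, torusChar d l y * f y ∂(nu d) = c l := by
    intro l
    have h1 : ∀ m y, torusChar d l y * (c m * torusChar d m (-y)) =
        c m * torusChar d (l - m) y := fun m y => by
      rw [torusChar_neg_right, sub_eq_add_neg, torusChar_add_left]; ring
    have h2 := hasSum_integral_of_summable_integral_norm (μ := nu d)
      (F := fun m y => c m * torusChar d (l - m) y)
      (fun m => hint (continuous_const.mul (continuous_torusChar d _)) ‖c m‖ fun y => by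
        rw [norm_mul, norm_torusChar, mul_one])
      (by simpa [norm_torusChar] using hc)
    have h3 : ∀ y, ∑' m, c m * torusChar d (l - m) y = torusChar d l y * f y := fun y => by
      rw [← (hf y).tsum_eq, ← tsum_mul_left]
      exact tsum_congr fun m => (h1 m y).symm
    simp only [h3, integral_const_mul, integral_torusChar, sub_eq_zero] at h2
    rw [← h2.tsum_eq, tsum_eq_single l]
    · simp
    · intro m hm
      simp [hm.symm]
  have hsq : ∀ y, HasSum (fun l => (starRingEnd ℂ) (c l) * (torusChar d l y * f y))
      ((‖f y‖ ^ 2 : ℝ) : ℂ) := fun y => by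
    have h1 := (Complex.hasSum_conj'.2 ((hf y))).mul_right (f y)
    have h2 : (starRingEnd ℂ) (f y) * f y = ((‖f y‖ ^ 2 : ℝ) : ℂ) := by
      rw [Complex.conj_mul']; push_cast; rfl
    rw [h2] at h1
    refine h1.congr_fun fun l => ?_
    rw [map_mul, torusChar_neg_right, torusChar_neg_left, Complex.conj_conj]
    ring
  have h2 := hasSum_integral_of_summable_integral_norm (μ := nu d)
    (F := fun l y => (starRingEnd ℂ) (c l) * (torusChar d l y * f y))
    (fun l => hint (continuous_const.mul ((continuous_torusChar d _).mul hfc))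
      (‖c l‖ * ∑' l, ‖c l‖) fun y => by
        rw [norm_mul, norm_mul, norm_torusChar, one_mul, RCLike.norm_conj]
        exact mul_le_mul_of_nonneg_left (hfb y) (norm_nonneg _))
    (by
      simp only [norm_mul, norm_torusChar, one_mul, RCLike.norm_conj, integral_const_mul]
      exact hc.mul_right _)
  simp only [(hsq _).tsum_eq, integral_const_mul, hcoef] at h2
  rw [integral_complex_ofReal] at h2
  have h3 : ∀ l, (starRingEnd ℂ) (c l) * c l = ((‖c l‖ ^ 2 : ℝ) : ℂ) := fun l => by
    rw [Complex.conj_mul']; push_cast; rfl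
  simp only [h3] at h2
  exact (Complex.hasSum_ofReal.1 h2).tsum_eq.symm

end Torus

/-- Young's inequality for integral operators whose kernel is uniformly in `L^r` in each
variable. -/
theorem eLpNorm_lintegral_mul_le {X : Type*} [MeasurableSpace X] {μ : Measure X} [SFinite μ]
    {F : X → X → ℝ≥0∞} (hF : Measurable (Function.uncurry F)) {g : X → ℝ≥0∞}
    (hg : Measurable g) {p : ℝ} {q : ℝ≥0∞} {r : ℝ} {R : ℝ≥0∞} (hp : 1 ≤ p) (hq : q ≠ 0)
    (hr : 0 < r) (hpq : 0 ≤ 1 / p - 1 / q.toReal) (hpqr : 1 / p - 1 / q.toReal = 1 - 1 / r)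
    (hFr : ∀ x, ∫⁻ y, F x y ^ r ∂μ ≤ R ^ r) (hFl : ∀ y, ∫⁻ x, F x y ^ r ∂μ ≤ R ^ r)
    (hgp : ∫⁻ y, g y ^ p ∂μ ≤ 1) :
    eLpNorm (fun x => ∫⁻ y, F x y * g y ∂μ) q μ ≤ R := by
  have hp0 : 0 < p := by linarith
  have hp' : 0 ≤ 1 - 1 / p := by
    rw [sub_nonneg, div_le_one hp0]; exact hp
  have hq' : 0 ≤ 1 / q.toReal := by positivity
  have hFx : ∀ x, Measurable (F x) := fun x => hF.of_uncurry_left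
  have hpt : ∀ x, ∫⁻ y, F x y * g y ∂μ ≤
      (∫⁻ y, F x y ^ r * g y ^ p ∂μ) ^ (1 / q.toReal) * R ^ (r * (1 - 1 / p)) := by
    intro x
    let f : Fin 3 → X → ℝ≥0∞ :=
      ![fun y => F x y ^ r * g y ^ p, fun y => F x y ^ r, fun y => g y ^ p]
    let w : Fin 3 → ℝ := ![1 / q.toReal, 1 - 1 / p, 1 / p - 1 / q.toReal]
    have h1 := lintegral_prod_norm_pow_le (μ := μ) (Finset.univ : Finset (Fin 3)) (f := f)
      (p := w) (fun i _ => by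
        have := hFx x
        fin_cases i <;> simp only [f] <;> refine Measurable.aemeasurable ?_
        · exact ((hFx x).pow_const r).mul (hg.pow_const p)
        · exact (hFx x).pow_const r
        · exact hg.pow_const p)
      (by simp [w, Fin.sum_univ_three]; ring)
      (fun i _ => by fin_cases i <;> simp only [w] <;> assumption)
    simp only [Fin.prod_univ_three, f, w, Matrix.cons_val_zero, Matrix.cons_val_one,
      Matrix.cons_val] at h1
    have h2 : ∀ y, (F x y ^ r * g y ^ p) ^ (1 / q.toReal) * (F x y ^ r) ^ (1 - 1 / p) *
        (g y ^ p) ^ (1 / p - 1 / q.toReal) = F x y * g y := by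
      intro y
      rw [ENNReal.mul_rpow_of_nonneg _ _ hq']
      have e1 : (F x y ^ r) ^ (1 / q.toReal) * (F x y ^ r) ^ (1 - 1 / p) = F x y := by
        rw [← ENNReal.rpow_add_of_nonneg _ _ hq' hp', ← ENNReal.rpow_mul]
        have : r * (1 / q.toReal + (1 - 1 / p)) = 1 := by
          rw [show 1 / q.toReal + (1 - 1 / p) = 1 / r by linarith]; field_simp
        rw [this, ENNReal.rpow_one]
      have e2 : (g y ^ p) ^ (1 / q.toReal) * (g y ^ p) ^ (1 / p - 1 / q.toReal) = g y := by
        rw [← ENNReal.rpow_add_of_nonneg _ _ hq' hpq, ← ENNReal.rpow_mul]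
        have : p * (1 / q.toReal + (1 / p - 1 / q.toReal)) = 1 := by
          rw [add_sub_cancel]; field_simp
        rw [this, ENNReal.rpow_one]
      calc _ = ((F x y ^ r) ^ (1 / q.toReal) * (F x y ^ r) ^ (1 - 1 / p)) *
            ((g y ^ p) ^ (1 / q.toReal) * (g y ^ p) ^ (1 / p - 1 / q.toReal)) := by ring
        _ = _ := by rw [e1, e2]
    simp only [h2] at h1
    refine h1.trans ?_
    rw [mul_assoc]
    refine mul_le_mul_right ?_ _
    refine (mul_le_mul' (ENNReal.rpow_le_rpow (hFr x) hp')
      (ENNReal.rpow_le_one hgp hpq)).trans_eq ?_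
    rw [mul_one, ENNReal.rpow_mul]
  by_cases hqt : q = ⊤
  · subst hqt
    rw [eLpNorm_exponent_top]
    refine essSup_le_of_ae_le _ (Filter.Eventually.of_forall fun x => ?_)
    refine (hpt x).trans_eq ?_
    rw [ENNReal.toReal_top, _root_.div_zero, ENNReal.rpow_zero, one_mul]
    rw [ENNReal.toReal_top, _root_.div_zero, sub_zero] at hpqr
    have : r * (1 - 1 / p) = 1 := by
      rw [hpqr]; field_simp; ring
    rw [this, ENNReal.rpow_one]
  · have hQ : 0 < q.toReal := ENNReal.toReal_pos hq hqt
    rw [eLpNorm_eq_lintegral_rpow_enorm_toReal hq hqt]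
    simp only [enorm_eq_self]
    have hJ : ∫⁻ x, ∫⁻ y, F x y ^ r * g y ^ p ∂μ ∂μ ≤ R ^ r := by
      rw [lintegral_lintegral_swap]
      · have : ∀ y, ∫⁻ x, F x y ^ r * g y ^ p ∂μ ≤ R ^ r * g y ^ p := fun y => by
          rw [lintegral_mul_const _ (hF.of_uncurry_right.pow_const r)]
          exact mul_le_mul_left (hFl y) _
        refine (lintegral_mono this).trans ?_
        rw [lintegral_const_mul _ (hg.pow_const p)]
        exact mul_le_of_le_one_right' hgp
      · exact ((hF.pow_const r).mul ((hg.comp measurable_snd).pow_const p)).aemeasurable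
    have hmeas : Measurable fun x => ∫⁻ y, F x y ^ r * g y ^ p ∂μ :=
      Measurable.lintegral_prod_right
        ((hF.pow_const r).mul ((hg.comp measurable_snd).pow_const p))
    have hle : ∫⁻ x, (∫⁻ y, F x y * g y ∂μ) ^ q.toReal ∂μ ≤
        R ^ r * R ^ (r * (1 - 1 / p) * q.toReal) := by
      calc _ ≤ ∫⁻ x, (∫⁻ y, F x y ^ r * g y ^ p ∂μ) * R ^ (r * (1 - 1 / p) * q.toReal) ∂μ := by
            refine lintegral_mono fun x => ?_
            refine (ENNReal.rpow_le_rpow (hpt x) hQ.le).trans_eq ?_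
            rw [ENNReal.mul_rpow_of_nonneg _ _ hQ.le, ← ENNReal.rpow_mul, ← ENNReal.rpow_mul,
              one_div_mul_cancel hQ.ne', ENNReal.rpow_one]
        _ ≤ _ := by
            rw [lintegral_mul_const _ hmeas]
            exact mul_le_mul_left hJ _
    refine (ENNReal.rpow_le_rpow hle hq').trans_eq ?_
    rw [← ENNReal.rpow_add_of_nonneg _ _ hr.le (by positivity), ← ENNReal.rpow_mul]
    have : (r + r * (1 - 1 / p) * q.toReal) * (1 / q.toReal) = 1 := by
      have h3 : r * (1 / q.toReal + (1 - 1 / p)) = 1 := by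
        rw [show 1 / q.toReal + (1 - 1 / p) = 1 / r by linarith]; field_simp
      have h4 : q.toReal * (1 / q.toReal) = 1 := mul_one_div_cancel hQ.ne'
      linear_combination h3 + r * (1 - 1 / p) * h4
    rw [this, ENNReal.rpow_one]

section Continuity

variable {d n : ℕ} {K : (Fin d → ℝ) → ℝ}

theorem continuous_fundSk (hK : Continuous K) : Continuous (fundSk d (fun _ => n) K) := by
  have h1 : ∀ j, Continuous (lam d (fun _ => n) K j) := fun j => by
    unfold lam
    fun_prop
  have h2 : ∀ j, Continuous (rho d (fun _ => n) K j) := fun j =>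
    continuous_const.mul (Complex.continuous_re.comp (h1 j))
  unfold fundSk
  exact continuous_const.add (continuous_const.mul
    (continuous_finsetSum _ fun j _ => (h2 j).div_const _))

theorem continuous_errKernel (hK : Continuous K) :
    Continuous (Function.uncurry (errKernel d n K)) := by
  have hs := continuous_fundSk (n := n) hK
  unfold Function.uncurry errKernel
  fun_prop

theorem convK_sub_skInterp (hK : Continuous K) {B : ℝ} (hB : ∀ x, |K x| ≤ B)
    {φ : (Fin d → ℝ) → ℝ} (hφ : Integrable φ (nu d)) (x : Fin d → ℝ) :
    convK d K φ x - skInterp d (fun _ => n) K (convK d K φ) x =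
      ∫ y, errKernel d n K x y * φ y ∂(nu d) := by
  have hint : ∀ z, Integrable (fun y => K (z - y) * φ y) (nu d) := fun z =>
    hφ.bdd_mul (hK.comp (continuous_const.sub continuous_id)).aestronglyMeasurable
      (Filter.Eventually.of_forall fun y => hB (z - y))
  have h1 : ∀ y, errKernel d n K x y * φ y = K (x - y) * φ y -
      ∑ k ∈ Omega d (fun _ => n), (K (knot d (fun _ => n) k - y) * φ y) *
        fundSk d (fun _ => n) K (x - knot d (fun _ => n) k) := fun y => by
    rw [errKernel, sub_mul, Finset.sum_mul]
    congr 1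
    exact Finset.sum_congr rfl fun k _ => by ring
  simp only [h1]
  rw [integral_sub (hint x) (integrable_finsetSum _ fun k _ => (hint _).mul_const _),
    integral_finsetSum _ fun k _ => (hint _).mul_const _]
  simp only [integral_mul_const]
  rfl

end Continuity

section Bounds

variable {d : ℕ} {γ : ℝ} {a : (Fin d → ℤ) → ℝ}

theorem integrable_sq_of_continuous_of_abs_le {f : (Fin d → ℝ) → ℝ} (hf : Continuous f) {M : ℝ}
    (hb : ∀ x, |f x| ≤ M) : Integrable (fun x => f x ^ 2) (nu d) := by
  refine Integrable.of_bound (hf.pow 2).aestronglyMeasurable (M ^ 2)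
    (Filter.Eventually.of_forall fun x => ?_)
  rw [Real.norm_eq_abs, abs_pow]
  exact pow_le_pow_left₀ (abs_nonneg _) (hb x) 2

theorem exists_errKernel_bound (hγ : (d : ℝ) < γ) (hnn : ∀ l, 0 ≤ a l)
    (hev : ∀ l, a (-l) = a l) (h0 : a 0 = 0) (hle : ∀ l, l ≠ 0 → a l ≤ ‖l‖ ^ (-γ)) :
    ∃ C : ℝ, 0 < C ∧ ∀ n : ℕ, 1 ≤ n →
      (∀ x y, |errKernel d n (Kr d a) x y| ≤ C * (n : ℝ) ^ (d - γ)) ∧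
      (∀ x, ∫ y, errKernel d n (Kr d a) x y ^ 2 ∂(nu d) ≤ C ^ 2 * (n : ℝ) ^ (d - 2 * γ)) ∧
      (∀ y, ∫ x, errKernel d n (Kr d a) x y ^ 2 ∂(nu d) ≤ C ^ 2 * (n : ℝ) ^ (d - 2 * γ)) := by
  have ha := summable_abs_of_le_norm_rpow hγ hnn h0 hle
  have hγ0 : 0 ≤ γ := (Nat.cast_nonneg d).trans hγ.le
  set S := ∑' m : Fin d → ℤ, (1 + ‖m‖) ^ (-γ) with hSdef
  have hS : 0 ≤ S := tsum_nonneg fun m => by positivity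
  set C1 := 2 + 2 * (2 ^ γ * S) with hC1
  set C2 := C1 * (2 ^ d * 2 ^ γ * S) with hC2
  set C3 := 2 ^ γ * S with hC3
  have hC1' : 0 ≤ C1 := by positivity
  have hC2' : 0 ≤ C2 := by positivity
  have hC3' : 0 ≤ C3 := by positivity
  set C := 1 + C2 + (2 * (C1 * C2) + 8 * C3 ^ 2) with hC
  have hCone : 1 ≤ C := by
    have : 0 ≤ C2 + (2 * (C1 * C2) + 8 * C3 ^ 2) := by positivity
    linarith
  have hCsq : 2 * (C1 * C2) + 8 * C3 ^ 2 ≤ C ^ 2 := by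
    have : 2 * (C1 * C2) + 8 * C3 ^ 2 ≤ C := by linarith
    nlinarith
  refine ⟨C, by linarith, fun n hn => ?_⟩
  have hn' : (1 : ℝ) ≤ n := by exact_mod_cast hn
  have hnpos : (0 : ℝ) < n := by linarith
  obtain ⟨hws, hwt⟩ := summable_truncWeight hn hγ
  have hcoef := norm_errCoeff_le_truncWeight (n := n) hn hγ hnn hev h0 hle
  have hcs : ∀ x, Summable fun l => ‖errCoeff d n a l x‖ := fun x =>
    Summable.of_nonneg_of_le (fun _ => norm_nonneg _) (fun l => hcoef l x) (hws.mul_left C1)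
  have hct : ∀ x, ∑' l, ‖errCoeff d n a l x‖ ≤ C2 * (n : ℝ) ^ (d - γ) := fun x => by
    refine ((hcs x).tsum_le_tsum (fun l => hcoef l x) (hws.mul_left C1)).trans ?_
    rw [tsum_mul_left, hC2, mul_assoc]
    exact mul_le_mul_of_nonneg_left hwt hC1'
  have hpow : (n : ℝ) ^ (-γ) * (n : ℝ) ^ (d - γ) = (n : ℝ) ^ (d - 2 * γ) := by
    rw [← Real.rpow_add hnpos]; congr 1; ring
  have hL2 : ∀ x, ∫ y, errKernel d n (Kr d a) x y ^ 2 ∂(nu d) ≤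
      C1 * C2 * (n : ℝ) ^ (d - 2 * γ) := by
    intro x
    have h1 := integral_normSq_of_hasSum (hcs x) fun y => hasSum_errKernel (n := n) ha hev x y
    simp only [Complex.norm_real, Real.norm_eq_abs, sq_abs] at h1
    rw [h1]
    have h2 : ∀ l, ‖errCoeff d n a l x‖ ^ 2 ≤
        (C1 * (n : ℝ) ^ (-γ)) * ‖errCoeff d n a l x‖ := fun l => by
      rw [sq]
      refine mul_le_mul_of_nonneg_right ((hcoef l x).trans ?_) (norm_nonneg _)
      exact mul_le_mul_of_nonneg_left (truncWeight_le hn hγ0 l) hC1'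
    have h3 := (hcs x).mul_left (C1 * (n : ℝ) ^ (-γ))
    refine ((Summable.of_nonneg_of_le (fun _ => sq_nonneg _) h2 h3).tsum_le_tsum h2 h3).trans ?_
    rw [tsum_mul_left]
    refine (mul_le_mul_of_nonneg_left (hct x) (by positivity)).trans_eq ?_
    rw [← hpow]; ring
  have hLpos : 0 ≤ (n : ℝ) ^ (d - 2 * γ) := by positivity
  have hsup : ∀ x y, |errKernel d n (Kr d a) x y| ≤ C * (n : ℝ) ^ (d - γ) := by
    intro x y
    have h1 := hasSum_errKernel (n := n) ha hev x y
    have h2 : ‖(errKernel d n (Kr d a) x y : ℂ)‖ ≤ ∑' l, ‖errCoeff d n a l x‖ := by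
      rw [← h1.tsum_eq]
      exact tsum_of_norm_bounded (hcs x).hasSum fun l => by
        rw [norm_mul, norm_torusChar, mul_one]
    rw [Complex.norm_real, Real.norm_eq_abs] at h2
    refine (h2.trans (hct x)).trans (mul_le_mul_of_nonneg_right ?_ (by positivity))
    have : 0 ≤ 2 * (C1 * C2) + 8 * C3 ^ 2 := by positivity
    linarith
  refine ⟨hsup, fun x => (hL2 x).trans (mul_le_mul_of_nonneg_right ?_ hLpos), fun y => ?_⟩
  · have h1 : 0 ≤ C1 * C2 := by positivity
    have h2 : 0 ≤ 8 * C3 ^ 2 := by positivity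
    linarith
  · have hE := continuous_errKernel (n := n) (continuous_Kr ha)
    have hEy : Continuous fun x => errKernel d n (Kr d a) x y := hE.uncurry_right y
    have hEx : Continuous fun x => errKernel d n (Kr d a) y x := hE.uncurry_left y
    have hEx2 := integrable_sq_of_continuous_of_abs_le hEx fun x => hsup y x
    have hpt : ∀ x, errKernel d n (Kr d a) x y ^ 2 ≤
        2 * errKernel d n (Kr d a) y x ^ 2 + 8 * C3 ^ 2 * (n : ℝ) ^ (d - 2 * γ) := by
      intro x
      have h1 := errKernel_sub_swap (n := n) hn ha hev x y
      have hA : ∀ z, |(aliasSum d n a 0 z).re| ≤ C3 * (n : ℝ) ^ (-γ) := fun z =>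
        (Complex.abs_re_le_norm _).trans (norm_aliasSum_zero_le hn hγ hnn h0 hle z)
      have h2 : |errKernel d n (Kr d a) x y - errKernel d n (Kr d a) y x| ≤
          2 * (C3 * (n : ℝ) ^ (-γ)) := by
        rw [h1]
        refine (abs_sub _ _).trans ?_
        linarith [hA x, hA y]
      have h3 : (errKernel d n (Kr d a) x y - errKernel d n (Kr d a) y x) ^ 2 ≤
          (2 * (C3 * (n : ℝ) ^ (-γ))) ^ 2 := sq_le_sq' (abs_le.1 h2).1 (abs_le.1 h2).2
      have h4 : (n : ℝ) ^ (-γ) * (n : ℝ) ^ (-γ) ≤ (n : ℝ) ^ (d - 2 * γ) := by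
        rw [← hpow]
        refine mul_le_mul_of_nonneg_left ?_ (by positivity)
        refine Real.rpow_le_rpow_of_exponent_le hn' ?_
        have : (0 : ℝ) ≤ d := Nat.cast_nonneg d
        linarith
      have h5 : 8 * C3 ^ 2 * ((n : ℝ) ^ (-γ) * (n : ℝ) ^ (-γ)) ≤
          8 * C3 ^ 2 * (n : ℝ) ^ (d - 2 * γ) := mul_le_mul_of_nonneg_left h4 (by positivity)
      nlinarith [sq_nonneg (errKernel d n (Kr d a) x y - 2 * errKernel d n (Kr d a) y x)]
    calc _ ≤ ∫ x, (2 * errKernel d n (Kr d a) y x ^ 2 + 8 * C3 ^ 2 * (n : ℝ) ^ (d - 2 * γ))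
          ∂(nu d) := integral_mono (integrable_sq_of_continuous_of_abs_le hEy fun x => hsup x y)
            ((hEx2.const_mul 2).add (integrable_const _)) hpt
      _ = 2 * ∫ x, errKernel d n (Kr d a) y x ^ 2 ∂(nu d) +
          8 * C3 ^ 2 * (n : ℝ) ^ (d - 2 * γ) := by
        rw [integral_add (hEx2.const_mul 2) (integrable_const _),
          integral_const_mul, integral_const]
        simp
      _ ≤ (2 * (C1 * C2) + 8 * C3 ^ 2) * (n : ℝ) ^ (d - 2 * γ) := by
        have := hL2 y
        linarith
      _ ≤ _ := mul_le_mul_of_nonneg_right hCsq hLpos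

/-- Interpolation between a uniform and a mean square bound. -/
theorem lintegral_enorm_rpow_le {X : Type*} [MeasurableSpace X] {μ : Measure X} {f : X → ℝ}
    (hf : Integrable (fun x => f x ^ 2) μ) {M V R r : ℝ} (hr : 2 ≤ r)
    (hM : ∀ x, |f x| ≤ M) (hM0 : 0 ≤ M) (hV : ∫ x, f x ^ 2 ∂μ ≤ V) (hR : 0 ≤ R)
    (hMVR : M ^ (r - 2) * V = R ^ r) :
    ∫⁻ x, ‖f x‖ₑ ^ r ∂μ ≤ ENNReal.ofReal R ^ r := by
  have hpt : ∀ x, ‖f x‖ₑ ^ r ≤ ENNReal.ofReal (M ^ (r - 2) * f x ^ 2) := fun x => by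
    rw [Real.enorm_eq_ofReal_abs, ENNReal.ofReal_rpow_of_nonneg (abs_nonneg _) (by linarith)]
    refine ENNReal.ofReal_le_ofReal ?_
    calc |f x| ^ r = |f x| ^ (r - 2) * |f x| ^ (2 : ℝ) := by
          rw [← Real.rpow_add_of_nonneg (abs_nonneg _) (by linarith) (by norm_num)]
          congr 1; ring
      _ ≤ _ := by
          rw [Real.rpow_two, sq_abs]
          exact mul_le_mul_of_nonneg_right
            (Real.rpow_le_rpow (abs_nonneg _) (hM x) (by linarith)) (sq_nonneg _)
  refine (lintegral_mono hpt).trans ?_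
  rw [← ofReal_integral_eq_lintegral_ofReal (hf.const_mul _)
    (Filter.Eventually.of_forall fun x => by positivity), integral_const_mul,
    ENNReal.ofReal_rpow_of_nonneg hR (by linarith), ← hMVR]
  exact ENNReal.ofReal_le_ofReal (mul_le_mul_of_nonneg_left hV (by positivity))

end Bounds

theorem abs_Kr_le {d : ℕ} {a : (Fin d → ℤ) → ℝ} (ha : Summable fun l => |a l|)
    (x : Fin d → ℝ) : |Kr d a x| ≤ ∑' l, |a l| := by
  refine (Complex.abs_re_le_norm _).trans ?_
  rw [Kc_eq]
  refine tsum_of_norm_bounded ha.hasSum fun l => ?_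
  rw [norm_mul, norm_torusChar, mul_one, Complex.norm_real, Real.norm_eq_abs]

theorem toReal_one_div_sub_bounds {p q : ℝ≥0∞} (hp1 : 1 ≤ p) (hp2 : p ≤ 2)
    (hpq : 1 / 2 ≤ 1 / p - 1 / q) :
    1 ≤ p.toReal ∧ 1 / 2 ≤ 1 / p.toReal - 1 / q.toReal ∧ 1 / p.toReal - 1 / q.toReal ≤ 1 ∧
      (1 / p.toReal - 1 / q.toReal = 1 → p = 1 ∧ q = ⊤) := by
  have hpt : p ≠ ⊤ := ne_top_of_le_ne_top ENNReal.ofNat_ne_top hp2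
  have hP : 1 ≤ p.toReal := by
    have := (ENNReal.toReal_le_toReal ENNReal.one_ne_top hpt).2 hp1
    simpa using this
  have hP1 : 1 / p.toReal ≤ 1 := by
    rw [div_le_one (by linarith)]; exact hP
  have hQ : 0 ≤ 1 / q.toReal := by positivity
  have hle : 1 / q ≤ 1 / p := by
    by_contra h
    rw [tsub_eq_zero_of_le (not_le.1 h).le] at hpq
    simp at hpq
  have hpi : 1 / p ≠ ⊤ := by
    simpa using (zero_lt_one.trans_le hp1).ne'
  have key : 1 / 2 ≤ 1 / p.toReal - 1 / q.toReal := by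
    have h1 := ENNReal.toReal_mono (ENNReal.sub_ne_top hpi) hpq
    rw [ENNReal.toReal_sub_of_le hle hpi] at h1
    simpa using h1
  refine ⟨hP, key, by linarith, fun h => ?_⟩
  have h1 : 1 / p.toReal = 1 := by linarith
  have h2 : 1 / q.toReal = 0 := by linarith
  constructor
  · rw [← ENNReal.ofReal_toReal hpt]
    have : p.toReal = 1 := by simpa using h1
    simp [this]
  · have : q.toReal = 0 := by simpa using h2
    rcases (ENNReal.toReal_eq_zero_iff q).1 this with h0 | h0
    · subst h0
      simp only [one_div, ENNReal.inv_zero, top_le_iff, ENNReal.inv_eq_top] at hle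
      simp [hle] at hp1
    · exact h0

/-- Theorem 4: optimal approximation rate for the Sobolev-type kernel
`K(x) = Σ_{l ≠ 0} |l|^{-γ} e^{i l·x}`. -/
theorem statement17 (d : ℕ) (hd : 1 ≤ d) (γ : ℝ) (hγ : (d : ℝ) < γ)
    (nrm : (Fin d → ℝ) → ℝ)
    (hnrm : (∀ x, nrm x = Real.sqrt (∑ i, x i ^ 2)) ∨ (∀ x, nrm x = ‖x‖))
    (p q : ℝ≥0∞) (hp1 : 1 ≤ p) (hp2 : p ≤ 2) (hq2 : 2 ≤ q)
    (hpq : 1 / 2 ≤ 1 / p - 1 / q) :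
    ∃ Cpq > 0, ∀ n : ℕ, 1 ≤ n →
      ∀ φ : (Fin d → ℝ) → ℝ, Measurable φ →
        (∀ (x : Fin d → ℝ) (m : Fin d → ℤ),
          φ (x + fun i => 2 * π * (m i : ℝ)) = φ x) →
        eLpNorm φ p (nu d) ≤ 1 →
        eLpNorm (fun x => convK d (Kr d (aGamma d γ nrm)) φ x -
            skInterp d (fun _ => n) (Kr d (aGamma d γ nrm))
              (convK d (Kr d (aGamma d γ nrm)) φ) x) q (nu d) ≤
          ENNReal.ofReal (Cpq *
            (n : ℝ) ^ (-γ + d * (1 / p.toReal - 1 / q.toReal))) := by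
  have hγ0 : 0 ≤ γ := (Nat.cast_nonneg d).trans hγ.le
  have hnn := aGamma_nonneg (γ := γ) hnrm
  have hev := aGamma_neg (γ := γ) hnrm
  have h0 : aGamma d γ nrm 0 = 0 := if_pos rfl
  have hle := fun l hl => aGamma_le hγ0 hnrm l hl
  have ha := summable_abs_of_le_norm_rpow hγ hnn h0 hle
  obtain ⟨C, hC, hbd⟩ := exists_errKernel_bound hγ hnn hev h0 hle
  refine ⟨C, hC, fun n hn φ hφm _ hφ => ?_⟩
  obtain ⟨hsup, hrow, hcol⟩ := hbd n hn
  set K := Kr d (aGamma d γ nrm) with hK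
  have hKc : Continuous K := continuous_Kr ha
  have hnpos : (0 : ℝ) < n := by exact_mod_cast hn
  have hp0 : p ≠ 0 := (zero_lt_one.trans_le hp1).ne'
  have hpt : p ≠ ⊤ := ne_top_of_le_ne_top ENNReal.ofNat_ne_top hp2
  have hq0 : q ≠ 0 := (lt_of_lt_of_le (by norm_num) hq2).ne'
  obtain ⟨hP, hθ, hθ1, hend⟩ := toReal_one_div_sub_bounds hp1 hp2 hpq
  have hφ1 : eLpNorm φ 1 (nu d) ≤ 1 :=
    (eLpNorm_le_eLpNorm_of_exponent_le hp1 hφm.aestronglyMeasurable).trans hφ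
  have hφi : Integrable φ (nu d) := memLp_one_iff_integrable.1
    ⟨hφm.aestronglyMeasurable, hφ1.trans_lt ENNReal.one_lt_top⟩
  simp only [convK_sub_skInterp hKc (abs_Kr_le ha) hφi]
  have hEc := continuous_errKernel (n := n) hKc
  have hmono : eLpNorm (fun x => ∫ y, errKernel d n K x y * φ y ∂(nu d)) q (nu d) ≤
      eLpNorm (fun x => ∫⁻ y, ‖errKernel d n K x y‖ₑ * ‖φ y‖ₑ ∂(nu d)) q (nu d) := by
    refine eLpNorm_mono_enorm fun x => ?_
    rw [enorm_eq_self]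
    refine (enorm_integral_le_lintegral_enorm _).trans_eq ?_
    simp only [enorm_mul]
  refine hmono.trans ?_
  have hMnn : 0 ≤ C * (n : ℝ) ^ (d - γ) := by positivity
  rcases eq_or_lt_of_le hθ1 with h1 | h1
  · obtain ⟨-, rfl⟩ := hend h1
    rw [h1, eLpNorm_exponent_top]
    refine essSup_le_of_ae_le _ (Filter.Eventually.of_forall fun x => ?_)
    rw [show -γ + d * 1 = d - γ by ring]
    calc ∫⁻ y, ‖errKernel d n K x y‖ₑ * ‖φ y‖ₑ ∂(nu d)
        ≤ ∫⁻ y, ENNReal.ofReal (C * (n : ℝ) ^ (d - γ)) * ‖φ y‖ₑ ∂(nu d) := by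
          refine lintegral_mono fun y => mul_le_mul_left ?_ _
          rw [Real.enorm_eq_ofReal_abs]
          exact ENNReal.ofReal_le_ofReal (hsup x y)
      _ ≤ _ := by
          rw [lintegral_const_mul _ hφm.enorm, ← eLpNorm_one_eq_lintegral_enorm]
          exact mul_le_of_le_one_right' hφ1
  · set θ := 1 / p.toReal - 1 / q.toReal with hθdef
    have hs : 0 < 1 - θ := by linarith
    have hr : 2 ≤ 1 / (1 - θ) := by
      rw [le_div_iff₀ hs]; linarith
    have hMVR : (C * (n : ℝ) ^ (d - γ)) ^ (1 / (1 - θ) - 2) *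
        (C ^ 2 * (n : ℝ) ^ (d - 2 * γ)) =
        (C * (n : ℝ) ^ (-γ + d * θ)) ^ (1 / (1 - θ)) := by
      rw [Real.mul_rpow hC.le (by positivity), Real.mul_rpow hC.le (by positivity),
        ← Real.rpow_mul hnpos.le, ← Real.rpow_mul hnpos.le, ← Real.rpow_two]
      calc _ = (C ^ (1 / (1 - θ) - 2) * C ^ (2 : ℝ)) *
            ((n : ℝ) ^ ((d - γ) * (1 / (1 - θ) - 2)) * (n : ℝ) ^ (d - 2 * γ)) := by ring
        _ = _ := by
          rw [← Real.rpow_add hC, ← Real.rpow_add hnpos]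
          congr 2
          · ring
          · field_simp; ring
    refine eLpNorm_lintegral_mul_le (p := p.toReal) (r := 1 / (1 - θ)) ?_ hφm.enorm hP hq0
      (by positivity) (by linarith) ?_ (fun x => ?_) (fun y => ?_) ?_
    · exact hEc.measurable.enorm
    · rw [one_div_one_div]; ring
    · exact lintegral_enorm_rpow_le
        (integrable_sq_of_continuous_of_abs_le (hEc.uncurry_left x) fun y => hsup x y) hr
        (fun y => hsup x y) hMnn (hrow x) (by positivity) hMVR
    · exact lintegral_enorm_rpow_le
        (integrable_sq_of_continuous_of_abs_le (hEc.uncurry_right y) fun x => hsup x y) hr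
        (fun x => hsup x y) hMnn (hcol y) (by positivity) hMVR
    · rw [eLpNorm_eq_lintegral_rpow_enorm_toReal hp0 hpt] at hφ
      by_contra h
      exact absurd hφ (not_le.2 (ENNReal.one_lt_rpow (not_le.1 h) (by positivity)))

end
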